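/- Let K be a number field and S a set of prime ideals of K. Then Σ_{N(a) ≤ X} μ_K(a)·𝟙_D(a) = o(X) as X → ∞, where 𝟙_D is the indicator function of D(K,S). -/

import Mathlib

open NumberField Ideal Filter

noncomputable section

namespace AlladiGen

variable (K : Type*) [Field K] [NumberField K]

open Classical in
/-- The generalized Möbius function on integral ideals. -/
def muK (a : Ideal (𝓞 K)) : ℤ :=
  if Squarefree a then (-1) ^ (Nat.card {p : Ideal (𝓞 K) // p.IsPrime ∧ a ≤ p}) else 0

/-- `p` is a prime ideal of minimal norm among those containing `a`. -/
def MinimalPrime (a p : Ideal (𝓞 K)) : Prop :=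
  p.IsPrime ∧ a ≤ p ∧ ∀ q : Ideal (𝓞 K), q.IsPrime → a ≤ q → absNorm p ≤ absNorm q

/-- `a ∈ D(K,S)`: `a` is distinguishable with minimal prime in `S`. -/
def InD (S : Set (Ideal (𝓞 K))) (a : Ideal (𝓞 K)) : Prop :=
  ∃ p : Ideal (𝓞 K), MinimalPrime K a p ∧ p ∈ S ∧ ∀ q : Ideal (𝓞 K), MinimalPrime K a q → q = p

/-- `π_S(K; X)`: number of prime ideals in `S` of norm at most `X`. -/
def primeCount (S : Set (Ideal (𝓞 K))) (X : ℝ) : ℕ :=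
  Nat.card {p : Ideal (𝓞 K) // p.IsPrime ∧ p ∈ S ∧ (absNorm p : ℝ) ≤ X}

/-- `S` has natural density `δ` within the prime ideals of `K`. -/
def HasPrimeDensity (S : Set (Ideal (𝓞 K))) (δ : ℝ) : Prop :=
  Tendsto (fun X : ℝ => (primeCount K S X : ℝ) / (primeCount K Set.univ X : ℝ))
    atTop (nhds δ)

/-- `M(a)`: the maximal norm of a prime ideal containing `a`. -/
def maxNorm (a : Ideal (𝓞 K)) : ℕ :=
  sSup (absNorm '' {p : Ideal (𝓞 K) | p.IsPrime ∧ a ≤ p})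

/-- `Q_S(a)`: number of primes in `S` containing `a` of maximal norm. -/
def QS (S : Set (Ideal (𝓞 K))) (a : Ideal (𝓞 K)) : ℕ :=
  Nat.card {p : Ideal (𝓞 K) // p.IsPrime ∧ a ≤ p ∧ p ∈ S ∧ absNorm p = maxNorm K a}

/-- `c_K`: residue of the Dedekind zeta function at 1, via the analytic class number formula. -/
def cK : ℝ :=
  (2 ^ (InfinitePlace.nrRealPlaces K) * (2 * Real.pi) ^ (InfinitePlace.nrComplexPlaces K) *
    NumberField.Units.regulator K * (NumberField.classNumber K)) /
  ((NumberField.Units.torsionOrder K : ℝ) * Real.sqrt |(NumberField.discr K : ℝ)|)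

/-- `Ψ(X,Y)`: number of `Y`-smooth nonzero integral ideals of norm at most `X`. -/
def Psi (X Y : ℝ) : ℕ :=
  Nat.card {a : Ideal (𝓞 K) // a ≠ ⊥ ∧ (absNorm a : ℝ) ≤ X ∧
    ∀ p : Ideal (𝓞 K), p.IsPrime → a ≤ p → (absNorm p : ℝ) ≤ Y}

/-- `[X]_K`: number of nonzero integral ideals of norm at most `X`. -/
def idealCount (X : ℝ) : ℕ := Nat.card {a : Ideal (𝓞 K) // a ≠ ⊥ ∧ (absNorm a : ℝ) ≤ X}

/-- The logarithmic integral `Li(X) = ∫_2^X dt / log t`. -/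
def Li (X : ℝ) : ℝ := ∫ t in (2:ℝ)..X, 1 / Real.log t


open MeasureTheory in
lemma fourier_ae_eq (f : ℝ → ℂ) (h1 : Integrable f) (h2 : MemLp f 2) :
    (FourierTransform.fourier (h2.toLp f) : Lp ℂ 2 (volume : Measure ℝ)) =ᵐ[volume]
      FourierTransform.fourier f := by
  have hcont : Continuous (FourierTransform.fourier f) :=
    VectorFourier.fourierIntegral_continuous Real.continuous_fourierChar
      (by exact continuous_inner) h1
  have key := ae_eq_zero_of_integral_contDiff_smul_eq_zero
    (μ := (volume : Measure ℝ))
    (f := fun x => (FourierTransform.fourier (h2.toLp f) : Lp ℂ 2 (volume : Measure ℝ)) x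
      - FourierTransform.fourier f x) ?_ ?_
  · filter_upwards [key] with x hx using sub_eq_zero.mp hx
  · exact ((Lp.memLp _).locallyIntegrable (by norm_num)).sub hcont.locallyIntegrable
  · intro g hg hgc
    have hgc' : HasCompactSupport (fun x => (g x : ℂ)) :=
      hgc.comp_left (g := fun x : ℝ => (x : ℂ)) (by simp)
    have hg' : ContDiff ℝ (⊤ : ℕ∞) (fun x => (g x : ℂ)) := Complex.ofRealCLM.contDiff.comp hg
    set φ : SchwartzMap ℝ ℂ := hgc'.toSchwartzMap hg' with hφ
    have hφx : ∀ x, φ x = (g x : ℂ) := fun x => rfl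
    have e1 := congrArg (fun T => T φ) (Lp.fourier_toTemperedDistribution_eq (h2.toLp f))
    simp only [TemperedDistribution.fourier_apply, Lp.toTemperedDistribution_apply] at e1
    have e2 : ∫ x, (FourierTransform.fourier φ) x • (h2.toLp f) x
        = ∫ x, (FourierTransform.fourier φ) x • f x :=
      integral_congr_ae (by filter_upwards [h2.coeFn_toLp] with x hx; rw [hx])
    have e3 : ∫ x, FourierTransform.fourier f x • φ x
        = ∫ x, f x • FourierTransform.fourier (φ : ℝ → ℂ) x := by
      have := VectorFourier.integral_fourierIntegral_smul_eq_flip (μ := (volume : Measure ℝ))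
        (ν := (volume : Measure ℝ)) (L := innerₗ ℝ)
        Real.continuous_fourierChar (by exact continuous_inner) h1 φ.integrable
      rw [flip_innerₗ] at this
      exact this
    have i1 : Integrable (fun x => g x • (FourierTransform.fourier (h2.toLp f) : Lp ℂ 2 (volume : Measure ℝ)) x) := by
      exact ((Lp.memLp _).locallyIntegrable (by norm_num)).integrable_smul_left_of_hasCompactSupport hg.continuous hgc
    have i2 : Integrable (fun x => g x • FourierTransform.fourier f x) :=
      hcont.locallyIntegrable.integrable_smul_left_of_hasCompactSupport hg.continuous hgc
    simp only [smul_sub]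
    rw [integral_sub i1 i2, sub_eq_zero]
    calc _ = ∫ x, φ x • (FourierTransform.fourier (h2.toLp f) : Lp ℂ 2 (volume : Measure ℝ)) x := by
            simp [hφx]
      _ = ∫ x, (FourierTransform.fourier φ) x • f x := by rw [← e1, e2]
      _ = ∫ x, f x • FourierTransform.fourier (φ : ℝ → ℂ) x := by
            simp [SchwartzMap.fourier_coe, mul_comm]
      _ = _ := by rw [← e3]; simp [hφx, mul_comm]

open MeasureTheory in
lemma plancherel (f : ℝ → ℂ) (h1 : Integrable f) (h2 : MemLp f 2) :
    MemLp (FourierTransform.fourier f) 2 (volume : Measure ℝ) ∧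
    ∫ x, ‖FourierTransform.fourier f x‖ ^ 2 = ∫ x, ‖f x‖ ^ 2 := by
  have hae := fourier_ae_eq f h1 h2
  have hm : MemLp (FourierTransform.fourier f) 2 (volume : Measure ℝ) :=
    (memLp_congr_ae hae).mp (Lp.memLp _)
  refine ⟨hm, ?_⟩
  have hn := Lp.norm_fourier_eq (h2.toLp f)
  have sq : ∀ F : Lp ℂ 2 (volume : Measure ℝ), ‖F‖ ^ 2 = ∫ x, ‖F x‖ ^ 2 := by
    intro F
    have := L2.inner_def (𝕜 := ℂ) F F
    rw [inner_self_eq_norm_sq_to_K] at this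
    simp only [inner_self_eq_norm_sq_to_K] at this
    norm_cast at this
  have e := congrArg (· ^ 2) hn
  simp only [sq] at e
  have e4 : ∫ x, ‖(h2.toLp f) x‖ ^ 2 = ∫ x, ‖f x‖ ^ 2 :=
    integral_congr_ae (by filter_upwards [h2.coeFn_toLp] with x hx; rw [hx])
  rw [← e4, ← e]
  exact integral_congr_ae (by filter_upwards [hae] with x hx; rw [hx])


open MeasureTheory in
lemma plancherel_angular (f : ℝ → ℂ) (h1 : Integrable f) (h2 : MemLp f 2) :
    Integrable (fun t : ℝ => ‖∫ u : ℝ, Complex.exp (-(t * u : ℝ) * Complex.I) * f u‖ ^ 2) ∧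
    ∫ t : ℝ, ‖∫ u : ℝ, Complex.exp (-(t * u : ℝ) * Complex.I) * f u‖ ^ 2
      = 2 * Real.pi * ∫ x, ‖f x‖ ^ 2 := by
  obtain ⟨hm, he⟩ := plancherel f h1 h2
  have hF : ∀ t : ℝ, ∫ u : ℝ, Complex.exp (-(t * u : ℝ) * Complex.I) * f u
      = FourierTransform.fourier f (t / (2 * Real.pi)) := by
    intro t
    rw [Real.fourier_eq']
    congr 1
    ext u
    simp only [smul_eq_mul, RCLike.inner_apply, conj_trivial]
    congr 2
    have : Real.pi ≠ 0 := Real.pi_ne_zero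
    have e : -2 * Real.pi * (t / (2 * Real.pi) * u) = -(t * u) := by field_simp
    rw [e]; push_cast; ring
  simp only [hF]
  have hi : Integrable (fun x => ‖FourierTransform.fourier f x‖ ^ 2) :=
    (memLp_two_iff_integrable_sq_norm hm.1).mp hm
  refine ⟨hi.comp_div (by positivity), ?_⟩
  rw [Measure.integral_comp_div (fun x => ‖FourierTransform.fourier f x‖ ^ 2), he, smul_eq_mul,
    abs_of_pos (by positivity)]

open MeasureTheory in
lemma dirichlet_plancherel (a : ℕ → ℂ) (σ : ℝ) (ha : LSeriesSummable a σ)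
    (κ : ℝ → ℂ) (B : ℝ) (hκ : Integrable κ) (hB : ∀ u, ‖κ u‖ ≤ B) :
    Integrable (fun t : ℝ => ‖LSeries a (σ + t * Complex.I) *
      ∫ u : ℝ, Complex.exp (-(t * u : ℝ) * Complex.I) * κ u‖ ^ 2) ∧
    Integrable (fun u : ℝ => ‖∑' n : ℕ, LSeries.term a σ n * κ (u - Real.log n)‖ ^ 2) ∧
    ∫ t : ℝ, ‖LSeries a (σ + t * Complex.I) *
      ∫ u : ℝ, Complex.exp (-(t * u : ℝ) * Complex.I) * κ u‖ ^ 2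
     = 2 * Real.pi * ∫ u : ℝ, ‖∑' n : ℕ, LSeries.term a σ n * κ (u - Real.log n)‖ ^ 2 := by
  have ha' : Summable (fun n => ‖LSeries.term a σ n‖) := ha.norm
  set f : ℝ → ℂ := fun u => ∑' n : ℕ, LSeries.term a σ n * κ (u - Real.log n) with hf
  have hInteg : ∀ n : ℕ, Integrable (fun u => LSeries.term a σ n * κ (u - Real.log n)) :=
    fun n => (hκ.comp_sub_right _).const_mul _
  have hB0 : 0 ≤ B := (norm_nonneg _).trans (hB 0)
  have hbd : ∀ u n, ‖LSeries.term a σ n * κ (u - Real.log n)‖ ≤ ‖LSeries.term a σ n‖ * B := by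
    intro u n
    rw [norm_mul]
    exact mul_le_mul_of_nonneg_left (hB _) (norm_nonneg _)
  have hsum : ∀ u, Summable (fun n : ℕ => LSeries.term a σ n * κ (u - Real.log n)) := fun u =>
    Summable.of_norm_bounded (ha'.mul_right B) (hbd u)
  have hmeas : AEStronglyMeasurable f volume := by
    refine aestronglyMeasurable_of_tendsto_ae atTop
      (f := fun N u => ∑ n ∈ Finset.range N, LSeries.term a σ n * κ (u - Real.log n)) ?_ ?_
    · intro N
      exact Finset.aestronglyMeasurable_fun_sum _ (fun n _ => (hInteg n).1)
    · exact Eventually.of_forall fun u => (hsum u).hasSum.tendsto_sum_nat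
  have hnorm : ∀ n : ℕ, ∫ u, ‖LSeries.term a σ n * κ (u - Real.log n)‖
      = ‖LSeries.term a σ n‖ * ∫ u, ‖κ u‖ := by
    intro n
    simp only [norm_mul]
    rw [integral_const_mul, integral_sub_right_eq_self (fun u => ‖κ u‖)]
  have hfint : Integrable f := by
    refine ⟨hmeas, ?_⟩
    have : ∫⁻ u, ‖f u‖ₑ ≤ ∑' n : ℕ, ∫⁻ u, ‖LSeries.term a σ n * κ (u - Real.log n)‖ₑ := by
      rw [← lintegral_tsum (fun n => (hInteg n).1.enorm)]
      exact lintegral_mono fun u => enorm_tsum_le_tsum_enorm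
    refine lt_of_le_of_lt this ?_
    have e : ∀ n : ℕ, ∫⁻ u, ‖LSeries.term a σ n * κ (u - Real.log n)‖ₑ
        = ENNReal.ofReal (‖LSeries.term a σ n‖ * ∫ u, ‖κ u‖) := by
      intro n
      rw [← hnorm, ofReal_integral_norm_eq_lintegral_enorm (hInteg n)]
    simp only [e]
    exact (ha'.mul_right _).tsum_ofReal_lt_top
  have hfB : ∀ u, ‖f u‖ ≤ ∑' n, ‖LSeries.term a σ n‖ * B := fun u =>
    tsum_of_norm_bounded (ha'.mul_right B).hasSum (hbd u)
  have hf2i : Integrable (fun u => ‖f u‖ ^ 2) := by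
    refine (hfint.norm.const_mul (∑' n, ‖LSeries.term a σ n‖ * B)).mono' (hmeas.norm.pow 2) ?_
    refine Eventually.of_forall fun u => ?_
    rw [Real.norm_of_nonneg (by positivity), pow_two]
    exact mul_le_mul_of_nonneg_right (hfB u) (norm_nonneg _)
  have hf2 : MemLp f 2 := (memLp_two_iff_integrable_sq_norm hmeas).mpr hf2i
  obtain ⟨p1, p2⟩ := plancherel_angular f hfint hf2
  have hF : ∀ t : ℝ, ∫ u : ℝ, Complex.exp (-(t * u : ℝ) * Complex.I) * f u
      = LSeries a (σ + t * Complex.I) *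
      ∫ u : ℝ, Complex.exp (-(t * u : ℝ) * Complex.I) * κ u := by
    intro t
    have hexp : ∀ x : ℝ, ‖Complex.exp (-(x : ℝ) * Complex.I)‖ = 1 := by
      intro x
      have := Complex.norm_exp_ofReal_mul_I (-x)
      simpa using this
    have hi2 : ∀ n : ℕ, Integrable (fun u : ℝ => Complex.exp (-(t * u : ℝ) * Complex.I) *
        (LSeries.term a σ n * κ (u - Real.log n))) := by
      intro n
      refine (hInteg n).bdd_mul (c := 1) (by fun_prop) (Eventually.of_forall fun u => ?_)
      rw [hexp]
    have := integral_tsum_of_summable_integral_norm hi2 (by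
      simp only [norm_mul, hexp, one_mul]
      simp only [norm_mul] at hnorm
      simp only [hnorm]
      exact ha'.mul_right _)
    simp only [tsum_mul_left] at this
    rw [hf, ← this, LSeries, ← tsum_mul_right]
    congr 1
    ext n
    have e1 : ∀ u : ℝ, Complex.exp (-(t * u : ℝ) * Complex.I) *
        (LSeries.term a σ n * κ (u - Real.log n))
        = (fun v : ℝ => (LSeries.term a σ n * Complex.exp (-(t * Real.log n : ℝ) * Complex.I)) *
          (Complex.exp (-(t * v : ℝ) * Complex.I) * κ v)) (u - Real.log n) := by
      intro u
      have : Complex.exp (-(t * u : ℝ) * Complex.I)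
        = Complex.exp (-(t * Real.log n : ℝ) * Complex.I) *
          Complex.exp (-(t * (u - Real.log n) : ℝ) * Complex.I) := by
        rw [← Complex.exp_add]; congr 1; push_cast; ring
      simp only
      rw [this]; ring
    simp only [e1]
    rw [integral_sub_right_eq_self (fun v : ℝ =>
      (LSeries.term a σ n * Complex.exp (-(t * Real.log n : ℝ) * Complex.I)) *
          (Complex.exp (-(t * v : ℝ) * Complex.I) * κ v)), integral_const_mul]
    congr 1
    rcases eq_or_ne n 0 with rfl | hn
    · simp
    · rw [LSeries.term_of_ne_zero hn, LSeries.term_of_ne_zero hn,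
        Complex.cpow_add _ _ (by exact_mod_cast hn), div_mul_eq_div_div]
      rw [div_eq_mul_inv (a n / (n:ℂ) ^ (σ:ℂ)), ← Complex.cpow_neg,
        Complex.cpow_def_of_ne_zero (by exact_mod_cast hn) (-(t * Complex.I)),
        Complex.natCast_log.symm]
      congr 2
      push_cast; ring
  simp only [hF] at p1 p2
  exact ⟨p1, hf2i, p2⟩


/-- one-sided exponential kernel -/
def kap (σ : ℝ) (u : ℝ) : ℂ := if 0 ≤ u then ((Real.exp (-σ * u) : ℝ) : ℂ) else 0

open MeasureTheory in
lemma kap_integrable {σ : ℝ} (hσ : 0 < σ) : Integrable (kap σ) := by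
  have h : IntegrableOn (fun u : ℝ => ((Real.exp (-σ * u) : ℝ) : ℂ)) (Set.Ici 0) := by
    rw [integrableOn_Ici_iff_integrableOn_Ioi]
    exact (integrableOn_exp_mul_Ioi (by linarith) 0).ofReal
  have := (integrable_indicator_iff measurableSet_Ici).mpr h
  refine this.congr (Eventually.of_forall fun u => ?_)
  simp [kap, Set.indicator]

lemma kap_bound {σ : ℝ} (hσ : 0 < σ) (u : ℝ) : ‖kap σ u‖ ≤ 1 := by
  unfold kap
  split_ifs with h
  · rw [Complex.norm_real, Real.norm_of_nonneg (Real.exp_pos _).le, Real.exp_le_one_iff]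
    nlinarith
  · simp

open MeasureTheory in
lemma kap_fourier {σ : ℝ} (hσ : 0 < σ) (t : ℝ) :
    ∫ u : ℝ, Complex.exp (-(t * u : ℝ) * Complex.I) * kap σ u = 1 / (σ + t * Complex.I) := by
  have h := integral_exp_mul_complex_Ioi (a := -(σ + t * Complex.I)) (by simpa using hσ) 0
  have e : ∀ u : ℝ, Complex.exp (-(t * u : ℝ) * Complex.I) * kap σ u
      = Set.indicator (Set.Ici 0) (fun u : ℝ => Complex.exp (-(σ + t * Complex.I) * u)) u := by
    intro u
    simp only [kap, Set.indicator, Set.mem_Ici]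
    split_ifs
    · rw [Complex.ofReal_exp, ← Complex.exp_add]; congr 1; push_cast; ring
    · simp
  simp only [e]
  rw [integral_indicator measurableSet_Ici, integral_Ici_eq_integral_Ioi, h]
  rw [neg_div_neg_eq]; simp

/-- smoothed kernel -/
def kap1 (σ : ℝ) (u : ℝ) : ℂ := kap σ u - kap (σ + 1) u

lemma kap1_bound {σ : ℝ} (hσ : 0 < σ) (u : ℝ) : ‖kap1 σ u‖ ≤ 2 := by
  have h1 := kap_bound hσ u
  have h2 := kap_bound (show 0 < σ + 1 by linarith) u
  exact (norm_sub_le _ _).trans (by linarith)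

open MeasureTheory in
lemma kap1_fourier {σ : ℝ} (hσ : 0 < σ) (t : ℝ) :
    ∫ u : ℝ, Complex.exp (-(t * u : ℝ) * Complex.I) * kap1 σ u
      = 1 / ((σ + t * Complex.I) * (σ + t * Complex.I + 1)) := by
  have hexp : ∀ x : ℝ, ‖Complex.exp (-(x : ℝ) * Complex.I)‖ = 1 := by
    intro x
    have := Complex.norm_exp_ofReal_mul_I (-x)
    simpa using this
  have hi : ∀ τ : ℝ, 0 < τ → Integrable (fun u : ℝ => Complex.exp (-(t * u : ℝ) * Complex.I) * kap τ u) := by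
    intro τ hτ
    refine (kap_integrable hτ).bdd_mul (c := 1) (by fun_prop) (Eventually.of_forall fun u => ?_)
    rw [hexp]
  simp only [kap1, mul_sub]
  rw [integral_sub (hi _ hσ) (hi _ (by linarith)), kap_fourier hσ, kap_fourier (by linarith)]
  have h1 : (σ + t * Complex.I : ℂ) ≠ 0 := by
    intro h; have := congrArg Complex.re h; simp at this; linarith
  have h2 : (σ + t * Complex.I + 1 : ℂ) ≠ 0 := by
    intro h; have := congrArg Complex.re h; simp at this; linarith
  have h3 : (((σ + 1 : ℝ) : ℂ) + t * Complex.I : ℂ) = σ + t * Complex.I + 1 := by push_cast; ring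
  rw [h3]
  field_simp
  ring

lemma mem_iff_log_le {u : ℝ} {n : ℕ} (hn : n ≠ 0) : 0 ≤ u - Real.log n ↔ n ≤ ⌊Real.exp u⌋₊ := by
  have hn' : (0:ℝ) < n := by exact_mod_cast Nat.pos_of_ne_zero hn
  rw [Nat.le_floor_iff (Real.exp_pos _).le, sub_nonneg, Real.log_le_iff_le_exp hn']

lemma kap_sum (a : ℕ → ℝ) (σ u : ℝ) :
    ∑' n : ℕ, LSeries.term (fun n => (a n : ℂ)) σ n * kap σ (u - Real.log n)
      = ((Real.exp (-σ * u) * ∑ n ∈ Finset.Ioc 0 ⌊Real.exp u⌋₊, a n : ℝ) : ℂ) := by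
  rw [tsum_eq_sum (s := Finset.Ioc 0 ⌊Real.exp u⌋₊)]
  · push_cast
    rw [Finset.mul_sum]
    refine Finset.sum_congr rfl fun n hn => ?_
    rw [Finset.mem_Ioc] at hn
    have hn0 : n ≠ 0 := by omega
    have hn' : (0:ℝ) < n := by exact_mod_cast hn.1
    rw [LSeries.term_of_ne_zero hn0, kap, if_pos ((mem_iff_log_le hn0).mpr hn.2)]
    rw [Complex.cpow_def_of_ne_zero (by exact_mod_cast hn0), div_eq_mul_inv, ← Complex.exp_neg,
      Complex.natCast_log.symm, mul_assoc, Complex.ofReal_exp, ← Complex.exp_add, mul_comm]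
    congr 2
    push_cast; ring
  · intro n hn
    rcases eq_or_ne n 0 with rfl | hn0
    · simp
    · rw [kap, if_neg, mul_zero]
      rw [mem_iff_log_le hn0]
      intro h
      exact hn (Finset.mem_Ioc.mpr ⟨Nat.pos_of_ne_zero hn0, h⟩)

lemma kap1_sum (a : ℕ → ℝ) (σ u : ℝ) :
    ∑' n : ℕ, LSeries.term (fun n => (a n : ℂ)) σ n * kap1 σ (u - Real.log n)
      = ((Real.exp (-(σ + 1) * u) *
        ∑ n ∈ Finset.Ioc 0 ⌊Real.exp u⌋₊, a n * (Real.exp u - n) : ℝ) : ℂ) := by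
  rw [tsum_eq_sum (s := Finset.Ioc 0 ⌊Real.exp u⌋₊)]
  · push_cast
    rw [Finset.mul_sum]
    refine Finset.sum_congr rfl fun n hn => ?_
    rw [Finset.mem_Ioc] at hn
    have hn0 : n ≠ 0 := by omega
    have hn' : (0:ℝ) < n := by exact_mod_cast hn.1
    have hl := (mem_iff_log_le hn0).mpr hn.2
    rw [LSeries.term_of_ne_zero hn0, kap1, kap, kap, if_pos hl, if_pos hl]
    have e1 : ((n : ℂ) ^ (σ : ℂ)) = ((Real.exp (σ * Real.log n) : ℝ) : ℂ) := by
      rw [Complex.cpow_def_of_ne_zero (by exact_mod_cast hn0), Complex.natCast_log.symm,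
        Complex.ofReal_exp]
      congr 1
      push_cast; ring
    have e2 : Real.exp (-σ * (u - Real.log n)) = Real.exp (σ * Real.log n) * Real.exp (-(σ + 1) * u) * Real.exp u := by
      rw [← Real.exp_add, ← Real.exp_add]; congr 1; ring
    have e3 : Real.exp (-(σ+1) * (u - Real.log n)) = Real.exp (σ * Real.log n) * Real.exp (-(σ + 1) * u) * n := by
      conv_rhs => arg 2; rw [← Real.exp_log hn']
      rw [← Real.exp_add, ← Real.exp_add]; congr 1; ring
    have e4 : ((Real.exp (σ * Real.log n) : ℝ) : ℂ) ≠ 0 := by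
      exact_mod_cast (Real.exp_pos _).ne'
    rw [e1, e2, e3]
    field_simp
    push_cast
    ring
  · intro n hn
    rcases eq_or_ne n 0 with rfl | hn0
    · simp
    · have : ¬ (0 ≤ u - Real.log n) := by
        rw [mem_iff_log_le hn0]
        intro h
        exact hn (Finset.mem_Ioc.mpr ⟨Nat.pos_of_ne_zero hn0, h⟩)
      rw [kap1, kap, kap, if_neg this, if_neg this]; simp


/-- The L-series of a real arithmetic function. -/
def Ls (f : ArithmeticFunction ℝ) (s : ℂ) : ℂ := LSeries (fun n => (f n : ℂ)) s

/-- The abstract hypotheses. -/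
structure Sys (r g Lm : ArithmeticFunction ℝ) (c C d : ℝ) : Prop where
  r_nonneg : ∀ n, 0 ≤ r n
  r_one : r 1 = 1
  g_le : ∀ n, |g n| ≤ r n
  Lm_nonneg : ∀ n, 0 ≤ Lm n
  Lm_le : ∀ n, Lm n ≤ d * ArithmeticFunction.vonMangoldt n
  rg : r * g = 1
  Lmr : Lm * r = r.pmul ArithmeticFunction.log
  c_pos : 0 < c
  d_nonneg : 0 ≤ d
  C_pos : 0 < C
  lim : Tendsto (fun x : ℝ => (∑ n ∈ Finset.Ioc 0 ⌊x⌋₊, r n) / x) atTop (nhds c)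
  bd : ∀ x : ℝ, 0 ≤ x → ∑ n ∈ Finset.Ioc 0 ⌊x⌋₊, r n ≤ C * x

lemma pmul_log_mul (f g : ArithmeticFunction ℝ) :
    (f * g).pmul ArithmeticFunction.log
      = f.pmul ArithmeticFunction.log * g + f * g.pmul ArithmeticFunction.log := by
  ext n
  simp only [ArithmeticFunction.pmul_apply, ArithmeticFunction.mul_apply,
    ArithmeticFunction.add_apply, ArithmeticFunction.log_apply]
  rw [Finset.sum_mul, ← Finset.sum_add_distrib]
  refine Finset.sum_congr rfl fun p hp => ?_
  rw [Nat.mem_divisorsAntidiagonal] at hp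
  have h1 : p.1 ≠ 0 := by rintro h; simp [h] at hp; omega
  have h2 : p.2 ≠ 0 := by rintro h; simp [h] at hp; omega
  rw [← hp.1]
  push_cast
  rw [Real.log_mul (by exact_mod_cast h1) (by exact_mod_cast h2)]
  ring

lemma Ls_mul {f g : ArithmeticFunction ℝ} {s : ℂ} (hf : LSeriesSummable (fun n => (f n : ℂ)) s)
    (hg : LSeriesSummable (fun n => (g n : ℂ)) s) : Ls (f * g) s = Ls f s * Ls g s := by
  unfold Ls
  rw [← LSeries_convolution' hf hg]
  congr 1
  ext n
  rw [LSeries.convolution_def]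
  simp [ArithmeticFunction.mul_apply]

namespace Sys
variable {r g Lm : ArithmeticFunction ℝ} {c C d : ℝ}

lemma glog (h : Sys r g Lm c C d) : g.pmul ArithmeticFunction.log = -(Lm * g) := by
  have h1 := pmul_log_mul r g
  rw [h.rg, ← h.Lmr, mul_assoc, h.rg, mul_one] at h1
  have h2 : (1 : ArithmeticFunction ℝ).pmul ArithmeticFunction.log = 0 := by
    ext n
    rw [ArithmeticFunction.pmul_apply, ArithmeticFunction.log_apply, ArithmeticFunction.one_apply]
    split_ifs with hn
    · simp [hn]
    · simp
  rw [h2] at h1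
  have h3 := congrArg (fun f => g * f) h1
  simp only [mul_zero, mul_add, ← mul_assoc] at h3
  rw [mul_comm g r, h.rg, one_mul, mul_comm g Lm] at h3
  exact eq_neg_of_add_eq_zero_right h3.symm

lemma bigO (h : Sys r g Lm c C d) :
    (fun n : ℕ => ∑ k ∈ Finset.Icc 1 n, r k) =O[atTop] fun n : ℕ => (n : ℝ) ^ (1:ℝ) := by
  refine Asymptotics.IsBigO.of_bound C (Eventually.of_forall fun n => ?_)
  have := h.bd n (by positivity)
  rw [Nat.floor_natCast] at this
  rw [Real.norm_of_nonneg (Finset.sum_nonneg fun k _ => h.r_nonneg k), Real.rpow_one,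
    Real.norm_of_nonneg (by positivity)]
  exact this

lemma summ_r (h : Sys r g Lm c C d) {s : ℂ} (hs : 1 < s.re) :
    LSeriesSummable (fun n => (r n : ℂ)) s :=
  LSeriesSummable_of_sum_norm_bigO_and_nonneg h.bigO h.r_nonneg zero_le_one hs

lemma summ_g (h : Sys r g Lm c C d) {s : ℂ} (hs : 1 < s.re) :
    LSeriesSummable (fun n => (g n : ℂ)) s := by
  refine Summable.of_norm_bounded (h.summ_r hs).norm fun n => ?_
  refine LSeries.norm_term_le s ?_
  rw [Complex.norm_real, Complex.norm_real, Real.norm_of_nonneg (h.r_nonneg n)]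
  exact h.g_le n

lemma summ_L (h : Sys r g Lm c C d) {s : ℂ} (hs : 1 < s.re) :
    LSeriesSummable (fun n => (Lm n : ℂ)) s := by
  have h1 := (ArithmeticFunction.LSeriesSummable_vonMangoldt hs).smul (d : ℂ)
  refine Summable.of_norm_bounded h1.norm fun n => ?_
  refine LSeries.norm_term_le s ?_
  rw [Complex.norm_real, Real.norm_of_nonneg (h.Lm_nonneg n)]
  simp only [Pi.smul_apply, smul_eq_mul]
  rw [← Complex.ofReal_mul, Complex.norm_real, Real.norm_of_nonneg]
  · exact h.Lm_le n
  · exact mul_nonneg h.d_nonneg ArithmeticFunction.vonMangoldt_nonneg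

lemma summ_Lg (h : Sys r g Lm c C d) {s : ℂ} (hs : 1 < s.re) :
    LSeriesSummable (fun n => ((Lm * g) n : ℂ)) s := by
  have := (h.summ_L hs).convolution (h.summ_g hs)
  refine (LSeriesSummable_congr s fun {n} hn => ?_).mp this
  rw [LSeries.convolution_def]
  simp [ArithmeticFunction.mul_apply]

lemma zG (h : Sys r g Lm c C d) {s : ℂ} (hs : 1 < s.re) : Ls r s * Ls g s = 1 := by
  rw [← Ls_mul (h.summ_r hs) (h.summ_g hs), h.rg]
  unfold Ls
  have e : (fun n => (((1 : ArithmeticFunction ℝ) n : ℝ) : ℂ)) = LSeries.delta := by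
    ext n
    simp only [ArithmeticFunction.one_apply, LSeries.delta]
    split_ifs <;> simp
  rw [e, LSeries_delta]; rfl

lemma z_ne (h : Sys r g Lm c C d) {s : ℂ} (hs : 1 < s.re) : Ls r s ≠ 0 := 
  left_ne_zero_of_mul_eq_one (h.zG hs)

lemma norm_G_inv (h : Sys r g Lm c C d) {s : ℂ} (hs : 1 < s.re) : ‖Ls g s‖ = ‖Ls r s‖⁻¹ := by
  rw [← norm_inv, eq_inv_of_mul_eq_one_right (h.zG hs)]

lemma absc (h : Sys r g Lm c C d) : LSeries.abscissaOfAbsConv (fun n => (r n : ℂ)) ≤ 1 := by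
  refine LSeries.abscissaOfAbsConv_le_of_forall_lt_LSeriesSummable fun y hy => h.summ_r (by simpa using hy)

lemma z_deriv (h : Sys r g Lm c C d) {s : ℂ} (hs : 1 < s.re) :
    HasDerivAt (Ls r) (-(Ls Lm s * Ls r s)) s := by
  have h1 := LSeries_hasDerivAt (f := fun n => (r n : ℂ)) (s := s)
    (h.absc.trans_lt (by exact_mod_cast hs))
  rw [← Ls_mul (h.summ_L hs) (h.summ_r hs), h.Lmr]
  have e : Ls (r.pmul ArithmeticFunction.log) s = LSeries (LSeries.logMul fun n => (r n : ℂ)) s := by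
    refine congrArg (fun f => LSeries f s) ?_
    ext n
    simp [LSeries.logMul, ArithmeticFunction.log_apply, mul_comm]
  rw [e]
  exact h1

/-- norm bound of L-series by L-series of majorant -/
lemma norm_le_real (h : Sys r g Lm c C d) {f : ArithmeticFunction ℝ} (hf : ∀ n, |f n| ≤ r n) {s : ℂ}
    (hs : 1 < s.re) : ‖Ls f s‖ ≤ ‖Ls r (s.re : ℂ)‖ := by
  have hs' : 1 < ((s.re : ℂ)).re := by simpa using hs
  have e : ∀ n, LSeries.term (fun n => (r n : ℂ)) (s.re : ℂ) n
      = ((‖LSeries.term (fun n => (r n : ℂ)) (s.re : ℂ) n‖ : ℝ) : ℂ) := by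
    intro n
    rcases eq_or_ne n 0 with rfl | hn
    · simp
    · rw [LSeries.term_of_ne_zero hn, norm_div, Complex.norm_natCast_cpow_of_pos (by omega),
        Complex.norm_real, Real.norm_of_nonneg (h.r_nonneg n)]
      push_cast
      rw [Complex.ofReal_cpow (by positivity)]
      simp
  have e2 : Ls r (s.re : ℂ) = ((∑' n, ‖LSeries.term (fun n => (r n : ℂ)) (s.re : ℂ) n‖ : ℝ) : ℂ) := by
    unfold Ls LSeries
    rw [Complex.ofReal_tsum]
    exact tsum_congr e
  rw [e2, Complex.norm_real, Real.norm_of_nonneg (tsum_nonneg fun _ => norm_nonneg _)]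
  refine tsum_of_norm_bounded (h.summ_r hs').norm.hasSum fun n => ?_
  have : ‖LSeries.term (fun n => (r n : ℂ)) (s.re : ℂ) n‖ = ‖LSeries.term (fun n => (r n : ℂ)) s n‖ := by
    rw [LSeries.norm_term_eq, LSeries.norm_term_eq]; simp
  rw [this]
  refine LSeries.norm_term_le s ?_
  rw [Complex.norm_real, Complex.norm_real, Real.norm_of_nonneg (h.r_nonneg n)]
  exact hf n

end Sys
namespace Sys
variable {r g Lm : ArithmeticFunction ℝ} {c C d : ℝ}

/-- the imaginary shift -/
lemma z_path (h : Sys r g Lm c C d) (t : ℝ) {σ : ℝ} (hσ : 1 < σ) :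
    HasDerivAt (fun x : ℝ => Ls r (x + t * Complex.I))
      (-(Ls Lm (σ + t * Complex.I) * Ls r (σ + t * Complex.I))) σ := by
  have h1 := h.z_deriv (s := σ + t * Complex.I) (by simpa using hσ)
  have h2 : HasDerivAt (fun x : ℂ => x + t * Complex.I) 1 (σ : ℂ) := (hasDerivAt_id _).add_const _
  have h3 := (HasDerivAt.comp (σ : ℂ) h1 h2).comp_ofReal
  simpa using h3

lemma re_L (h : Sys r g Lm c C d) (t : ℝ) {σ : ℝ} (hσ : 1 < σ) :
    HasSum (fun n : ℕ => Lm n * ((n : ℝ) ^ (-σ) * Real.cos (t * Real.log n)))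
      (Ls Lm (σ + t * Complex.I)).re := by
  have h1 : HasSum _ (Ls Lm (σ + t * Complex.I)) :=
    (h.summ_L (s := σ + t * Complex.I) (by simpa using hσ)).hasSum
  have h2 := Complex.hasSum_re h1
  convert h2 using 2 with n
  rcases eq_or_ne n 0 with rfl | hn
  · simp
  · have hn' : (0:ℝ) < n := by exact_mod_cast Nat.pos_of_ne_zero hn
    rw [LSeries.term_of_ne_zero hn, div_eq_mul_inv, ← Complex.cpow_neg, Complex.re_ofReal_mul,
      Complex.cpow_def_of_ne_zero (by exact_mod_cast hn), Complex.natCast_log.symm, Complex.exp_re,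
      Real.rpow_def_of_pos hn']
    have l1 : (Complex.log n).re = Real.log n := by
      rw [← Complex.natCast_log]; exact Complex.ofReal_re _
    have l2 : (Complex.log n).im = 0 := by
      rw [← Complex.natCast_log]; exact Complex.ofReal_im _
    congr 2
    · congr 1; simp [l1, l2]
    · rw [← Real.cos_neg]; congr 1; simp [l1, l2]; ring

lemma re_341 (h : Sys r g Lm c C d) (t : ℝ) {σ : ℝ} (hσ : 1 < σ) :
    0 ≤ 3 * (Ls Lm σ).re + 4 * (Ls Lm (σ + t * Complex.I)).re
      + (Ls Lm (σ + (2 * t : ℝ) * Complex.I)).re := by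
  have h0 := (h.re_L 0 hσ).mul_left 3
  have h1 := (h.re_L t hσ).mul_left 4
  have h2 := h.re_L (2 * t) hσ
  have h3 := ((h0.add h1).add h2)
  simp only [Complex.ofReal_zero, zero_mul, add_zero] at h3
  refine h3.nonneg fun n => ?_
  have e : Real.cos (2 * t * Real.log n) = 2 * Real.cos (t * Real.log n) ^ 2 - 1 := by
    rw [mul_assoc, Real.cos_two_mul]
  rw [e, Real.cos_zero]
  have hp : 0 ≤ Lm n * (n : ℝ) ^ (-σ) := mul_nonneg (h.Lm_nonneg n) (by positivity)
  have : 0 ≤ Lm n * (n : ℝ) ^ (-σ) * (2 * (1 + Real.cos (t * Real.log n)) ^ 2) := by positivity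
  nlinarith

lemma z_lim (h : Sys r g Lm c C d) (t : ℝ) :
    Tendsto (fun x : ℝ => Ls r (x + t * Complex.I)) atTop (nhds 1) := by
  let f : ℕ → ℂ := fun n => (r n : ℂ) * (n : ℂ) ^ (-(t * Complex.I))
  have e : ∀ x : ℝ, Ls r (x + t * Complex.I) = LSeries f x := by
    intro x
    unfold Ls LSeries
    refine tsum_congr fun n => ?_
    rcases eq_or_ne n 0 with rfl | hn
    · simp
    · have hn' : (n : ℂ) ≠ 0 := by exact_mod_cast hn
      rw [LSeries.term_of_ne_zero hn, LSeries.term_of_ne_zero hn, Complex.cpow_add _ _ hn']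
      simp only [f]
      rw [Complex.cpow_neg]
      field_simp
  have hs : LSeriesSummable f ((2 : ℝ) : ℂ) := by
    have h1 := h.summ_r (s := ((2 : ℝ) : ℂ) + t * Complex.I) (by simp)
    refine h1.congr fun n => ?_
    rcases eq_or_ne n 0 with rfl | hn
    · simp
    · have hn' : (n : ℂ) ≠ 0 := by exact_mod_cast hn
      rw [LSeries.term_of_ne_zero hn, LSeries.term_of_ne_zero hn, Complex.cpow_add _ _ hn']
      simp only [f]
      rw [Complex.cpow_neg]
      field_simp
  have h2 := LSeries.tendsto_atTop (f := f)
    (hs.abscissaOfAbsConv_le.trans_lt (EReal.coe_lt_top _))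
  have e1 : f 1 = 1 := by simp [f, h.r_one]
  rw [e1] at h2
  simpa only [e] using h2

lemma three_four_one (h : Sys r g Lm c C d) (t : ℝ) {σ : ℝ} (hσ : 1 < σ) :
    1 ≤ ‖Ls r σ‖ ^ 3 * ‖Ls r (σ + t * Complex.I)‖ ^ 4 * ‖Ls r (σ + (2 * t : ℝ) * Complex.I)‖ := by
  let Z : ℝ → ℂ := fun x => Ls r (x + (0 : ℝ) * Complex.I) ^ 3 * Ls r (x + t * Complex.I) ^ 4
    * Ls r (x + (2 * t : ℝ) * Complex.I)
  let Q : ℝ → ℂ := fun x => 3 * Ls Lm (x + (0 : ℝ) * Complex.I) + 4 * Ls Lm (x + t * Complex.I)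
    + Ls Lm (x + (2 * t : ℝ) * Complex.I)
  have hd : ∀ x : ℝ, 1 < x → HasDerivAt Z (-(Q x) * Z x) x := by
    intro x hx
    have := (((h.z_path 0 hx).pow 3).mul ((h.z_path t hx).pow 4)).mul (h.z_path (2 * t) hx)
    refine this.congr_deriv ?_
    simp only [Q, Z, Pi.mul_apply, Pi.pow_apply]
    push_cast
    ring
  have hN : ∀ x : ℝ, 1 < x → HasDerivAt (fun x => ‖Z x‖ ^ 2) (-2 * (Q x).re * ‖Z x‖ ^ 2) x := by
    intro x hx
    refine ((hd x hx).norm_sq).congr_deriv ?_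
    rw [Complex.inner, ← Complex.normSq_eq_norm_sq, Complex.normSq_apply]
    simp
    ring
  have hQ : ∀ x : ℝ, 1 < x → 0 ≤ (Q x).re := by
    intro x hx
    have := h.re_341 t hx
    simp only [Q, Complex.add_re, Complex.ofReal_zero, zero_mul, add_zero]
    simpa using this
  have hanti : AntitoneOn (fun x => ‖Z x‖ ^ 2) (Set.Ioi 1) := by
    refine antitoneOn_of_deriv_nonpos (convex_Ioi 1)
      (fun x hx => (hN x hx).continuousAt.continuousWithinAt)
      (fun x hx => (hN x (by simpa using hx)).differentiableAt.differentiableWithinAt) ?_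
    intro x hx
    rw [interior_Ioi] at hx
    rw [(hN x hx).deriv]
    have := hQ x hx
    have : 0 ≤ (Q x).re * ‖Z x‖ ^ 2 := by positivity
    linarith
  have hlim : Tendsto (fun x => ‖Z x‖ ^ 2) atTop (nhds 1) := by
    have := ((((h.z_lim 0).pow 3).mul ((h.z_lim t).pow 4)).mul (h.z_lim (2 * t))).norm.pow 2
    simpa [Z] using this
  have h1 : 1 ≤ ‖Z σ‖ ^ 2 := by
    refine le_of_tendsto hlim ?_
    filter_upwards [eventually_ge_atTop σ] with x hx
    exact hanti hσ (lt_of_lt_of_le hσ hx) hx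
  have h2 : 1 ≤ ‖Z σ‖ := by
    by_contra hc
    push Not at hc
    nlinarith [norm_nonneg (Z σ)]
  simpa [Z] using h2

end Sys
namespace Sys
variable {r g Lm : ArithmeticFunction ℝ} {c C d : ℝ}

/-- counting function -/
def Nf (r : ArithmeticFunction ℝ) (x : ℝ) : ℝ := ∑ n ∈ Finset.Ioc 0 ⌊x⌋₊, r n

lemma Nf_meas (r : ArithmeticFunction ℝ) : Measurable (Nf r) := by
  have : Measurable (fun n : ℕ => ∑ n ∈ Finset.Ioc 0 n, r n) := measurable_from_nat
  exact this.comp Nat.measurable_floor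

lemma Nf_nonneg (h : Sys r g Lm c C d) (x : ℝ) : 0 ≤ Nf r x :=
  Finset.sum_nonneg fun n _ => h.r_nonneg n

lemma Ls_integral (h : Sys r g Lm c C d) {s : ℂ} (hs : 1 < s.re) :
    Ls r s = s * ∫ t in Set.Ioi (1 : ℝ), (Nf r t : ℂ) * (t : ℂ) ^ (-(s + 1)) := by
  have := LSeries_eq_mul_integral_of_nonneg (fun n => r n) zero_le_one hs h.bigO h.r_nonneg
  unfold Ls
  rw [this]
  congr 2
  ext t
  congr 1
  unfold Nf
  push_cast
  rfl

lemma norm_cpow_t {s : ℂ} {t : ℝ} (ht : 1 < t) : ‖(t : ℂ) ^ (-(s + 1))‖ = t ^ (-(s.re + 1)) := by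
  rw [Complex.norm_cpow_eq_rpow_re_of_pos (by linarith)]
  simp

open MeasureTheory in
lemma int_rpow {δ : ℝ} (hδ : 0 < δ) : ∫ t in Set.Ioi (1 : ℝ), t ^ (-(1 + δ)) = 1 / δ := by
  rw [integral_Ioi_rpow_of_lt (by linarith) one_pos]
  simp [neg_div]

open MeasureTheory in
lemma zr_le (h : Sys r g Lm c C d) {δ : ℝ} (hδ : 0 < δ) (hδ1 : δ ≤ 1) :
    ‖Ls r ((1 + δ : ℝ) : ℂ)‖ ≤ 2 * C / δ := by
  rw [h.Ls_integral (by simpa using hδ), norm_mul]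
  have h1 : ‖∫ t in Set.Ioi (1 : ℝ), (Nf r t : ℂ) * (t : ℂ) ^ (-(((1 + δ : ℝ) : ℂ) + 1))‖
      ≤ ∫ t in Set.Ioi (1 : ℝ), C * t ^ (-(1 + δ)) := by
    refine norm_integral_le_of_norm_le
      ((integrableOn_Ioi_rpow_of_lt (by linarith) one_pos).const_mul C) ?_
    refine (ae_restrict_iff' measurableSet_Ioi).mpr (Eventually.of_forall fun t ht => ?_)
    have ht : 1 < t := ht
    rw [norm_mul, norm_cpow_t ht, Complex.norm_real, Real.norm_of_nonneg (h.Nf_nonneg t)]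
    have h2 := h.bd t (by linarith)
    have h3 : t ^ (-(1 + δ)) = t * t ^ (-(((1 + δ : ℝ) : ℂ).re + 1)) := by
      rw [← Real.rpow_one_add' (by linarith) (by simp; linarith)]
      congr 1; simp
    rw [h3, ← mul_assoc]
    exact mul_le_mul_of_nonneg_right h2 (by positivity)
  rw [integral_const_mul, int_rpow hδ] at h1
  have h2 : ‖((1 + δ : ℝ) : ℂ)‖ ≤ 2 := by
    rw [Complex.norm_real, Real.norm_of_nonneg (by linarith)]; linarith
  have hC := h.C_pos
  calc _ ≤ 2 * (C * (1 / δ)) := by gcongr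
    _ = _ := by ring

lemma eps_bd (h : Sys r g Lm c C d) {ε : ℝ} (hε : 0 < ε) :
    ∃ B : ℝ, 0 ≤ B ∧ ∀ t : ℝ, 0 ≤ t → |Nf r t - c * t| ≤ ε * t + B := by
  have h1 := Metric.tendsto_nhds.mp h.lim ε hε
  obtain ⟨t0, ht0⟩ := eventually_atTop.mp h1
  have hC := h.C_pos
  have hc := h.c_pos
  refine ⟨(C + c) * max t0 1, by positivity, fun t ht => ?_⟩
  rcases le_total (max t0 1) t with htt | htt
  · have h2 := ht0 t ((le_max_left _ _).trans htt)
    have ht' : 0 < t := lt_of_lt_of_le one_pos ((le_max_right _ _).trans htt)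
    rw [Real.dist_eq] at h2
    have : Nf r t - c * t = ((∑ n ∈ Finset.Ioc 0 ⌊t⌋₊, r n) / t - c) * t := by
      unfold Nf; field_simp
    rw [this, abs_mul, abs_of_pos ht']
    have : 0 ≤ (C + c) * max t0 1 := by positivity
    nlinarith
  · have h2 := h.bd t ht
    have h3 := h.Nf_nonneg t
    have h4 : Nf r t ≤ C * t := h2
    have : (C + c) * t ≤ (C + c) * max t0 1 := by gcongr
    rw [abs_le]
    constructor <;> nlinarith

open MeasureTheory in
lemma int_N (h : Sys r g Lm c C d) {s : ℂ} (hs : 1 < s.re) :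
    IntegrableOn (fun t : ℝ => (Nf r t : ℂ) * (t : ℂ) ^ (-(s + 1))) (Set.Ioi 1) := by
  refine Integrable.mono' (g := fun t : ℝ => C * t ^ (-s.re))
    ((integrableOn_Ioi_rpow_of_lt (by linarith) one_pos).const_mul C) ?_ ?_
  · refine AEStronglyMeasurable.mul ?_ ?_
    · exact (Complex.measurable_ofReal.comp (Nf_meas r)).aestronglyMeasurable
    · refine ContinuousOn.aestronglyMeasurable ?_ measurableSet_Ioi
      intro t ht
      have ht : 1 < t := ht
      refine ContinuousAt.continuousWithinAt ?_
      refine ContinuousAt.comp (f := fun t : ℝ => (t : ℂ)) (g := fun z : ℂ => z ^ (-(s + 1))) ?_ (Complex.continuous_ofReal.continuousAt)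
      refine continuousAt_cpow_const ?_
      left; simp; linarith
  · refine (ae_restrict_iff' measurableSet_Ioi).mpr (Eventually.of_forall fun t ht => ?_)
    have ht : 1 < t := ht
    rw [norm_mul, norm_cpow_t ht, Complex.norm_real, Real.norm_of_nonneg (h.Nf_nonneg t)]
    have h2 := h.bd t (by linarith)
    have h3 : t ^ (-s.re) = t * t ^ (-(s.re + 1)) := by
      rw [← Real.rpow_one_add' (by linarith) (by simp; linarith)]
      congr 1; simp
    rw [h3, ← mul_assoc]
    exact mul_le_mul_of_nonneg_right h2 (by positivity)

open MeasureTheory in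
lemma Ls_sub (h : Sys r g Lm c C d) {s : ℂ} (hs : 1 < s.re) :
    Ls r s - c * s / (s - 1)
      = s * ∫ t in Set.Ioi (1 : ℝ), ((Nf r t - c * t : ℝ) : ℂ) * (t : ℂ) ^ (-(s + 1)) := by
  have e1 : ∀ t ∈ Set.Ioi (1:ℝ), (c : ℂ) * (t : ℂ) ^ (-s) = (c * t : ℂ) * (t : ℂ) ^ (-(s + 1)) := by
    intro t ht
    have ht : 1 < t := ht
    have ht' : (t : ℂ) ≠ 0 := by exact_mod_cast (by linarith : t ≠ 0)
    rw [mul_assoc]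
    congr 1
    rw [neg_add, Complex.cpow_add _ _ ht', Complex.cpow_neg_one]
    field_simp
  have hi : IntegrableOn (fun t : ℝ => (c : ℂ) * (t : ℂ) ^ (-s)) (Set.Ioi 1) :=
    (integrableOn_Ioi_cpow_of_lt (by simpa using hs) one_pos).const_mul _
  have h1 : ∫ t in Set.Ioi (1 : ℝ), (c : ℂ) * (t : ℂ) ^ (-s) = c / (s - 1) := by
    rw [integral_const_mul, integral_Ioi_cpow_of_lt (by simpa using hs) one_pos]
    have : s - 1 ≠ 0 := by
      intro hh; have := congrArg Complex.re hh; simp at this; linarith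
    have h' : -s + 1 ≠ 0 := by
      intro hh; apply this; linear_combination -hh
    simp only [Complex.ofReal_one, Complex.one_cpow]
    field_simp
    ring
  have h2 : ∀ t ∈ Set.Ioi (1:ℝ), ((Nf r t - c * t : ℝ) : ℂ) * (t : ℂ) ^ (-(s + 1))
      = (Nf r t : ℂ) * (t : ℂ) ^ (-(s + 1)) - (c : ℂ) * (t : ℂ) ^ (-s) := by
    intro t ht
    rw [e1 t ht]; push_cast; ring
  rw [setIntegral_congr_fun measurableSet_Ioi h2, integral_sub (h.int_N hs) hi, h1,
    h.Ls_integral hs]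
  ring

open MeasureTheory in
lemma lemmaB (h : Sys r g Lm c C d) {ε T : ℝ} (hε : 0 < ε) (hT : 0 ≤ T) :
    ∃ δ0 > 0, ∀ δ t : ℝ, 0 < δ → δ < δ0 → |t| ≤ T →
      ‖Ls r (((1 + δ : ℝ) : ℂ) + t * Complex.I) - c * (((1 + δ : ℝ) : ℂ) + t * Complex.I)
        / (((1 + δ : ℝ) : ℂ) + t * Complex.I - 1)‖ ≤ ε / δ := by
  obtain ⟨B, hB, hb⟩ := h.eps_bd (ε := ε / (2 * (2 + T))) (by positivity)
  refine ⟨min 1 (ε / (2 * (B + 1) * (2 + T))), by positivity, fun δ t hδ hδ0 ht => ?_⟩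
  have hδ1 : δ < 1 := hδ0.trans_le (min_le_left _ _)
  have hδ2 : δ < ε / (2 * (B + 1) * (2 + T)) := hδ0.trans_le (min_le_right _ _)
  set s : ℂ := ((1 + δ : ℝ) : ℂ) + t * Complex.I with hsdef
  have hre : s.re = 1 + δ := by simp [hsdef]
  have hs : 1 < s.re := by rw [hre]; linarith
  rw [h.Ls_sub hs, norm_mul]
  set ε' := ε / (2 * (2 + T)) with hε'
  have h1 : ‖∫ t in Set.Ioi (1 : ℝ), ((Nf r t - c * t : ℝ) : ℂ) * (t : ℂ) ^ (-(s + 1))‖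
      ≤ ∫ t in Set.Ioi (1 : ℝ), (ε' * t ^ (-(1 + δ)) + B * t ^ (-(1 + (1 + δ)))) := by
    refine norm_integral_le_of_norm_le
      (((integrableOn_Ioi_rpow_of_lt (by linarith) one_pos).const_mul _).add
      ((integrableOn_Ioi_rpow_of_lt (by linarith) one_pos).const_mul _)) ?_
    refine (ae_restrict_iff' measurableSet_Ioi).mpr (Eventually.of_forall fun t ht => ?_)
    have ht : 1 < t := ht
    rw [norm_mul, norm_cpow_t ht, Complex.norm_real, Real.norm_eq_abs, hre]
    have h3 : t ^ (-(1 + δ)) = t * t ^ (-(1 + (1 + δ))) := by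
      rw [← Real.rpow_one_add' (by linarith) (by linarith)]
      congr 1; ring
    rw [h3, ← mul_assoc, ← add_mul, add_comm (1+δ) 1]
    exact mul_le_mul_of_nonneg_right (hb t (by linarith)) (by positivity)
  rw [integral_add ((integrableOn_Ioi_rpow_of_lt (by linarith) one_pos).const_mul _)
      ((integrableOn_Ioi_rpow_of_lt (by linarith) one_pos).const_mul _), integral_const_mul,
      integral_const_mul, int_rpow hδ, int_rpow (by linarith)] at h1
  have h2 : ‖s‖ ≤ 2 + T := by
    refine (norm_add_le _ _).trans ?_
    rw [norm_mul, Complex.norm_I, Complex.norm_real, Complex.norm_real, mul_one,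
      Real.norm_of_nonneg (by linarith), Real.norm_eq_abs]
    linarith
  have h3 : B * (1 / (1 + δ)) ≤ B := by
    have : 1 / (1 + δ) ≤ 1 := by rw [div_le_one (by linarith)]; linarith
    nlinarith
  have h4 : (2 + T) * B ≤ ε / (2 * δ) := by
    rw [le_div_iff₀ (by positivity)]
    rw [lt_div_iff₀ (by positivity)] at hδ2
    have : 0 ≤ (2 + T) * δ := by positivity
    nlinarith
  calc _ ≤ (2 + T) * (ε' * (1 / δ) + B) := by gcongr; linarith
    _ = ε / (2 * δ) + (2 + T) * B := by rw [hε']; field_simp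
    _ ≤ ε / (2 * δ) + ε / (2 * δ) := by gcongr
    _ = ε / δ := by field_simp; ring

lemma lemmaA (h : Sys r g Lm c C d) {ε T : ℝ} (hε : 0 < ε) (hT : 0 ≤ T) :
    ∃ δ0 > 0, ∀ δ t : ℝ, 0 < δ → δ < δ0 → |t| ≤ T →
      ‖Ls g (((1 + δ : ℝ) : ℂ) + t * Complex.I)‖ ≤ ε / δ := by
  have hC := h.C_pos
  have hc := h.c_pos
  set D := (2 * C) ^ 3 with hD
  have hDp : 0 < D := by positivity
  set A := 2 * D * c * (1 + T) / ε ^ 4 with hA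
  have hAp : 0 < A := by positivity
  obtain ⟨δ1, hpδa, h1⟩ := h.lemmaB (ε := c / (2 * (1 + A))) (T := 2 * T) (by positivity) (by positivity)
  obtain ⟨δ2, hpδb, h2⟩ := h.lemmaB (ε := ε ^ 4 / (2 * D)) (T := 2 * T) (by positivity) (by positivity)
  refine ⟨min (min δ1 δ2) (min 1 (ε * c / (2 * (1 + A)))), by positivity, fun δ t hδ hδ0 ht => ?_⟩
  simp only [lt_min_iff] at hδ0
  obtain ⟨⟨hd1, hd2⟩, hd3, hd4⟩ := hδ0
  have hsre : ∀ t : ℝ, (((1 + δ : ℝ) : ℂ) + t * Complex.I).re = 1 + δ := by intro t; simp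
  have hs : ∀ t : ℝ, 1 < (((1 + δ : ℝ) : ℂ) + t * Complex.I).re := by
    intro t; rw [hsre]; linarith
  have hsub : ∀ t : ℝ, ((1 + δ : ℝ) : ℂ) + t * Complex.I - 1 = δ + t * Complex.I := by
    intro t; push_cast; ring
  rw [h.norm_G_inv (hs t)]
  have hz : 0 < ‖Ls r (((1 + δ : ℝ) : ℂ) + t * Complex.I)‖ := norm_pos_iff.mpr (h.z_ne (hs t))
  rcases le_total |t| (A * δ) with htA | htA
  · have h3 := h1 δ t hδ hd1 (by linarith)
    have h4 : c / (δ * (1 + A)) ≤ ‖(c * (((1 + δ : ℝ) : ℂ) + t * Complex.I)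
        / (((1 + δ : ℝ) : ℂ) + t * Complex.I - 1) : ℂ)‖ := by
      rw [hsub, norm_div, norm_mul, Complex.norm_real, Real.norm_of_nonneg hc.le]
      have n1 : 1 ≤ ‖((1 + δ : ℝ) : ℂ) + t * Complex.I‖ :=
        (hs t).le.trans (Complex.re_le_norm _)
      have n2 : ‖(δ : ℂ) + t * Complex.I‖ ≤ δ * (1 + A) := by
        refine (norm_add_le _ _).trans ?_
        rw [norm_mul, Complex.norm_I, Complex.norm_real, Complex.norm_real, mul_one,
          Real.norm_of_nonneg hδ.le, Real.norm_eq_abs]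
        linarith
      have n3 : 0 < ‖(δ : ℂ) + t * Complex.I‖ := by
        rw [norm_pos_iff]; intro hh; have := congrArg Complex.re hh; simp at this; linarith
      calc c / (δ * (1 + A)) ≤ c / ‖(δ : ℂ) + t * Complex.I‖ := by gcongr
        _ ≤ _ := by gcongr; nlinarith
    have h5 := norm_sub_norm_le (c * (((1 + δ : ℝ) : ℂ) + t * Complex.I)
        / (((1 + δ : ℝ) : ℂ) + t * Complex.I - 1) : ℂ) (Ls r (((1 + δ : ℝ) : ℂ) + t * Complex.I))
    rw [norm_sub_rev] at h5
    have h6 : c / (2 * (1 + A)) / δ ≤ ‖Ls r (((1 + δ : ℝ) : ℂ) + t * Complex.I)‖ := by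
      have : c / (δ * (1 + A)) = c / (2 * (1 + A)) / δ + c / (2 * (1 + A)) / δ := by
        field_simp; ring
      linarith
    rw [inv_le_comm₀ hz (by positivity)]
    refine le_trans ?_ h6
    rw [inv_div, div_div, div_le_div_iff₀ hε (by positivity)]
    rw [lt_div_iff₀ (by positivity)] at hd4
    have : 0 ≤ δ * (2 * (1 + A)) := by positivity
    have : δ * (2 * (1 + A)) * δ ≤ δ * (2 * (1 + A)) := by nlinarith
    linarith
  · have h3 := h2 δ (2 * t) hδ hd2 (by rw [abs_mul, abs_two]; linarith)
    have h4 : ‖(c * (((1 + δ : ℝ) : ℂ) + (2 * t : ℝ) * Complex.I)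
        / (((1 + δ : ℝ) : ℂ) + (2 * t : ℝ) * Complex.I - 1) : ℂ)‖ ≤ c * (2 * (1 + T)) / (2 * (A * δ)) := by
      rw [hsub, norm_div, norm_mul, Complex.norm_real, Real.norm_of_nonneg hc.le]
      have n1 : ‖((1 + δ : ℝ) : ℂ) + (2 * t : ℝ) * Complex.I‖ ≤ 2 * (1 + T) := by
        refine (norm_add_le _ _).trans ?_
        rw [norm_mul, Complex.norm_I, Complex.norm_real, Complex.norm_real, mul_one,
          Real.norm_of_nonneg (by linarith), Real.norm_eq_abs, abs_mul, abs_two]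
        linarith
      have n2 : 2 * (A * δ) ≤ ‖(δ : ℂ) + (2 * t : ℝ) * Complex.I‖ := by
        refine le_trans ?_ (Complex.abs_im_le_norm _)
        simp only [Complex.add_im, Complex.ofReal_im, zero_add, Complex.mul_im, Complex.ofReal_re, Complex.I_im,
          Complex.I_re, mul_one, mul_zero, add_zero, abs_mul, abs_two]
        linarith
      gcongr
    have h5 := norm_le_norm_sub_add (Ls r (((1 + δ : ℝ) : ℂ) + (2 * t : ℝ) * Complex.I)) (c * (((1 + δ : ℝ) : ℂ) + (2 * t : ℝ) * Complex.I)
        / (((1 + δ : ℝ) : ℂ) + (2 * t : ℝ) * Complex.I - 1) : ℂ)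
    have h6 : ‖Ls r (((1 + δ : ℝ) : ℂ) + (2 * t : ℝ) * Complex.I)‖ ≤ ε ^ 4 / D / δ := by
      have : ε ^ 4 / D / δ = ε ^ 4 / (2 * D) / δ + c * (2 * (1 + T)) / (2 * (A * δ)) := by
        rw [hA]; field_simp; ring
      linarith
    have h7 := h.three_four_one t (σ := 1 + δ) (by linarith)
    have h8 := h.zr_le hδ hd3.le
    have h9 : 1 ≤ (ε / δ) ^ 4 * ‖Ls r (((1 + δ : ℝ) : ℂ) + t * Complex.I)‖ ^ 4 := by
      calc 1 ≤ _ := h7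
        _ ≤ (2 * C / δ) ^ 3 * ‖Ls r (((1 + δ : ℝ) : ℂ) + t * Complex.I)‖ ^ 4 * (ε ^ 4 / D / δ) := by gcongr
        _ = _ := by rw [hD]; field_simp
    rw [← mul_pow] at h9
    have h10 : 1 ≤ ε / δ * ‖Ls r (((1 + δ : ℝ) : ℂ) + t * Complex.I)‖ := by
      by_contra hcon
      push Not at hcon
      have := pow_lt_one₀ (by positivity) hcon (n := 4) (by norm_num)
      linarith
    rwa [inv_le_iff_one_le_mul₀ hz]

end Sys
namespace Sys
variable {r g Lm : ArithmeticFunction ℝ} {c C d : ℝ}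

lemma psi_le {x : ℝ} (hx : 0 ≤ x) : ∑ n ∈ Finset.Ioc 0 ⌊x⌋₊, ArithmeticFunction.vonMangoldt n ≤ 6 * x := by
  have h1 := Chebyshev.psi_le_const_mul_self hx
  have h2 : Real.log 4 ≤ 2 := by
    have : (4:ℝ) = 2 ^ 2 := by norm_num
    rw [this, Real.log_pow]
    have := Real.log_two_lt_d9
    push_cast; linarith
  have h3 : Chebyshev.psi x = ∑ n ∈ Finset.Ioc 0 ⌊x⌋₊, ArithmeticFunction.vonMangoldt n := rfl
  rw [← h3]
  nlinarith

lemma psiL_le (h : Sys r g Lm c C d) {x : ℝ} (hx : 0 ≤ x) : ∑ n ∈ Finset.Ioc 0 ⌊x⌋₊, Lm n ≤ 6 * d * x := by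
  have h1 := psi_le hx
  calc _ ≤ ∑ n ∈ Finset.Ioc 0 ⌊x⌋₊, d * ArithmeticFunction.vonMangoldt n :=
        Finset.sum_le_sum fun n _ => h.Lm_le n
    _ = d * ∑ n ∈ Finset.Ioc 0 ⌊x⌋₊, ArithmeticFunction.vonMangoldt n := by rw [Finset.mul_sum]
    _ ≤ d * (6 * x) := by have := h.d_nonneg; gcongr
    _ = _ := by ring

open MeasureTheory in
lemma lemmaC (h : Sys r g Lm c C d) : ∃ C1 : ℝ, 0 ≤ C1 ∧ ∀ δ : ℝ, 0 < δ →
    Integrable (fun t : ℝ => ‖Ls Lm (((1 + δ : ℝ) : ℂ) + t * Complex.I) /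
      (((1 + δ : ℝ) : ℂ) + t * Complex.I)‖ ^ 2) ∧
    ∫ t : ℝ, ‖Ls Lm (((1 + δ : ℝ) : ℂ) + t * Complex.I) /
      (((1 + δ : ℝ) : ℂ) + t * Complex.I)‖ ^ 2 ≤ C1 / δ := by
  refine ⟨2 * Real.pi * ((6 * d) ^ 2 / 2), by positivity, fun δ hδ => ?_⟩
  have hσ : 0 < 1 + δ := by linarith
  obtain ⟨i1, i2, e⟩ := dirichlet_plancherel (fun n => (Lm n : ℂ)) (1 + δ)
    (h.summ_L (by simpa using hδ)) (kap (1 + δ)) 1 (kap_integrable hσ) (kap_bound hσ)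
  simp only [kap_fourier hσ, kap_sum] at i1 i2 e
  simp only [mul_one_div] at i1 e
  refine ⟨i1, ?_⟩
  have e' : ∫ t : ℝ, ‖Ls Lm (((1 + δ : ℝ) : ℂ) + t * Complex.I) /
      (((1 + δ : ℝ) : ℂ) + t * Complex.I)‖ ^ 2 = _ := e
  rw [e', mul_div_assoc]
  refine mul_le_mul_of_nonneg_left ?_ (by positivity)
  let B : ℝ → ℝ := Set.indicator (Set.Ioi 0) (fun u => (6 * d) ^ 2 * Real.exp (-(2 * δ) * u))
  have hBi : Integrable B := by
    rw [integrable_indicator_iff measurableSet_Ioi]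
    exact (integrableOn_exp_mul_Ioi (by linarith) 0).const_mul _
  have hB : ∫ u, B u = (6 * d) ^ 2 / 2 / δ := by
    rw [integral_indicator measurableSet_Ioi, integral_const_mul, integral_exp_mul_Ioi (by linarith)]
    simp
    field_simp
  rw [← hB]
  refine integral_mono_ae i2 hBi ?_
  have hne : ∀ᵐ u : ℝ, u ≠ 0 := by
    simp [ae_iff]
  filter_upwards [hne] with u hu
  rw [Complex.norm_real, Real.norm_eq_abs, sq_abs]
  simp only [B, Set.indicator, Set.mem_Ioi]
  split_ifs with hu0
  · have h1 := h.psiL_le (Real.exp_pos u).le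
    have h0 : 0 ≤ ∑ n ∈ Finset.Ioc 0 ⌊Real.exp u⌋₊, Lm n := Finset.sum_nonneg fun n _ => h.Lm_nonneg n
    have h2 : Real.exp (-(1 + δ) * u) * ∑ n ∈ Finset.Ioc 0 ⌊Real.exp u⌋₊, Lm n
        ≤ 6 * d * Real.exp (-δ * u) := by
      calc _ ≤ Real.exp (-(1 + δ) * u) * (6 * d * Real.exp u) := by gcongr
        _ = 6 * d * (Real.exp (-(1 + δ) * u) * Real.exp u) := by ring
        _ = _ := by rw [← Real.exp_add]; congr 2; ring
    calc _ ≤ (6 * d * Real.exp (-δ * u)) ^ 2 := by gcongr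
      _ = (6 * d) ^ 2 * (Real.exp (-δ * u)) ^ 2 := by ring
      _ = _ := by rw [← Real.exp_nat_mul]; congr 2; push_cast; ring
  · have : u < 0 := lt_of_le_of_ne (not_lt.mp hu0) hu
    have : ⌊Real.exp u⌋₊ = 0 := by rw [Nat.floor_eq_zero]; rw [← Real.exp_zero]; exact Real.exp_lt_exp.mpr this
    rw [this]; simp

/-- log-weighted smoothed sum -/
def L1 (g : ArithmeticFunction ℝ) (x : ℝ) : ℝ :=
  ∑ n ∈ Finset.Ioc 0 ⌊x⌋₊, g n * Real.log n * (x - n)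

open MeasureTheory in
lemma lemmaD (h : Sys r g Lm c C d) {ε : ℝ} (hε : 0 < ε) : ∃ δ0 > 0, ∀ δ : ℝ, 0 < δ → δ < δ0 →
    Integrable (fun u : ℝ => (Real.exp (-(2 + δ) * u) * L1 g (Real.exp u)) ^ 2) ∧
    ∫ u : ℝ, (Real.exp (-(2 + δ) * u) * L1 g (Real.exp u)) ^ 2 ≤ ε / δ ^ 3 := by
  obtain ⟨C1, hC1, hC⟩ := h.lemmaC
  have hCp := h.C_pos
  set ε' := Real.sqrt (ε / (C1 + 1)) with hε'
  have hε'p : 0 < ε' := Real.sqrt_pos.mpr (by positivity)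
  have hsq : ε' ^ 2 = ε / (C1 + 1) := Real.sq_sqrt (by positivity)
  obtain ⟨δ0, hδ0, hA⟩ := h.lemmaA (ε := ε') (T := 2 * C / ε') hε'p (by positivity)
  refine ⟨min δ0 1, by positivity, fun δ hδ hδ' => ?_⟩
  rw [lt_min_iff] at hδ'
  obtain ⟨hd1, hd2⟩ := hδ'
  have hσ : 0 < 1 + δ := by linarith
  have hs : ∀ t : ℝ, 1 < (((1 + δ : ℝ) : ℂ) + t * Complex.I).re := by
    intro t; simpa using hδ
  have hsum : LSeriesSummable (fun n => (((g.pmul ArithmeticFunction.log) n : ℝ) : ℂ)) ((1 + δ : ℝ) : ℂ) := by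
    rw [h.glog]
    have := (h.summ_Lg (s := ((1 + δ : ℝ) : ℂ)) (by simpa using hδ)).neg
    refine this.congr fun n => ?_
    congr 1
    ext n; simp
  obtain ⟨i1, i2, e⟩ := dirichlet_plancherel (fun n => (((g.pmul ArithmeticFunction.log) n : ℝ) : ℂ)) (1 + δ)
    hsum (kap1 (1 + δ)) 2 ((kap_integrable hσ).sub (kap_integrable (by linarith))) (kap1_bound hσ)
  simp only [kap1_fourier hσ, kap1_sum] at i1 i2 e
  have hL : ∀ t : ℝ, LSeries (fun n => (((g.pmul ArithmeticFunction.log) n : ℝ) : ℂ)) (((1 + δ : ℝ) : ℂ) + t * Complex.I)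
      = - (Ls Lm (((1 + δ : ℝ) : ℂ) + t * Complex.I) * Ls g (((1 + δ : ℝ) : ℂ) + t * Complex.I)) := by
    intro t
    rw [← Ls_mul (h.summ_L (hs t)) (h.summ_g (hs t)), h.glog]
    unfold Ls
    rw [← LSeries_neg]
    congr 1
    ext n; simp
  simp only [hL] at i1 e
  have hconv : ∀ u : ℝ, ‖((Real.exp (-(1 + δ + 1) * u) *
        ∑ n ∈ Finset.Ioc 0 ⌊Real.exp u⌋₊, (g.pmul ArithmeticFunction.log) n * (Real.exp u - n) : ℝ) : ℂ)‖ ^ 2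
      = (Real.exp (-(2 + δ) * u) * L1 g (Real.exp u)) ^ 2 := by
    intro u
    rw [Complex.norm_real, Real.norm_eq_abs, sq_abs]
    unfold L1
    simp only [ArithmeticFunction.pmul_apply, ArithmeticFunction.log_apply]
    congr 3
    ring
  simp only [hconv] at i2 e
  refine ⟨i2, ?_⟩
  have hle : ∫ t : ℝ, ‖-(Ls Lm (((1 + δ : ℝ) : ℂ) + t * Complex.I) * Ls g (((1 + δ : ℝ) : ℂ) + t * Complex.I)) *
      (1 / ((((1 + δ : ℝ) : ℂ) + t * Complex.I) * (((1 + δ : ℝ) : ℂ) + t * Complex.I + 1)))‖ ^ 2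
      ≤ ∫ t : ℝ, (ε' / δ) ^ 2 * ‖Ls Lm (((1 + δ : ℝ) : ℂ) + t * Complex.I) /
      (((1 + δ : ℝ) : ℂ) + t * Complex.I)‖ ^ 2 := by
    refine integral_mono i1 ((hC δ hδ).1.const_mul _) fun t => ?_
    have hkey : ‖Ls g (((1 + δ : ℝ) : ℂ) + t * Complex.I) / (((1 + δ : ℝ) : ℂ) + t * Complex.I + 1)‖ ≤ ε' / δ := by
      rw [norm_div]
      have n1 : 1 ≤ ‖((1 + δ : ℝ) : ℂ) + t * Complex.I + 1‖ := by
        refine le_trans ?_ (Complex.re_le_norm _)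
        rw [Complex.add_re]
        have := hs t
        simp only [Complex.one_re]; linarith
      have n2 : |t| ≤ ‖((1 + δ : ℝ) : ℂ) + t * Complex.I + 1‖ := by
        refine le_trans ?_ (Complex.abs_im_le_norm _)
        simp
      rcases le_total |t| (2 * C / ε') with ht | ht
      · have := hA δ t hδ hd1 ht
        refine (div_le_self (norm_nonneg _) n1).trans this
      · have h1 := h.norm_le_real h.g_le (hs t)
        have h2 : (((1 + δ : ℝ) : ℂ) + t * Complex.I).re = 1 + δ := by simp
        rw [h2] at h1
        have h3 := h1.trans (h.zr_le hδ hd2.le)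
        rw [div_le_iff₀ (by linarith)]
        calc _ ≤ 2 * C / δ := h3
          _ = ε' / δ * (2 * C / ε') := by field_simp
          _ ≤ _ := by gcongr; exact ht.trans n2
    have heq : -(Ls Lm (((1 + δ : ℝ) : ℂ) + t * Complex.I) * Ls g (((1 + δ : ℝ) : ℂ) + t * Complex.I)) *
      (1 / ((((1 + δ : ℝ) : ℂ) + t * Complex.I) * (((1 + δ : ℝ) : ℂ) + t * Complex.I + 1)))
      = - ((Ls g (((1 + δ : ℝ) : ℂ) + t * Complex.I) / (((1 + δ : ℝ) : ℂ) + t * Complex.I + 1)) * (Ls Lm (((1 + δ : ℝ) : ℂ) + t * Complex.I) / (((1 + δ : ℝ) : ℂ) + t * Complex.I))) := by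
      rw [one_div, mul_inv]
      generalize (((1 + δ : ℝ) : ℂ) + t * Complex.I + 1) = w
      generalize (((1 + δ : ℝ) : ℂ) + t * Complex.I) = s
      ring
    beta_reduce
    rw [heq, norm_neg, norm_mul, mul_pow]
    gcongr
  rw [e, integral_const_mul] at hle
  have h5 := (hC δ hδ).2
  have hI : 0 ≤ ∫ u : ℝ, (Real.exp (-(2 + δ) * u) * L1 g (Real.exp u)) ^ 2 :=
    integral_nonneg fun u => by positivity
  have hpi := Real.pi_gt_three
  calc ∫ u : ℝ, (Real.exp (-(2 + δ) * u) * L1 g (Real.exp u)) ^ 2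
      ≤ 2 * Real.pi * ∫ u : ℝ, (Real.exp (-(2 + δ) * u) * L1 g (Real.exp u)) ^ 2 := by nlinarith
    _ ≤ _ := hle
    _ ≤ (ε' / δ) ^ 2 * (C1 / δ) := by gcongr
    _ = (ε / (C1 + 1)) * C1 / δ ^ 3 := by rw [div_pow, hsq]; field_simp
    _ ≤ ε / δ ^ 3 := by
      gcongr
      rw [div_mul_eq_mul_div, div_le_iff₀ (by positivity)]
      nlinarith

end Sys
namespace Sys
variable {r g Lm : ArithmeticFunction ℝ} {c C d : ℝ}

/-- smoothed sum -/
def Tf (g : ArithmeticFunction ℝ) (x : ℝ) : ℝ := ∑ n ∈ Finset.Ioc 0 ⌊x⌋₊, g n * (x - n)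

/-- normalized smoothed sum -/
def wf (g : ArithmeticFunction ℝ) (u : ℝ) : ℝ := |Tf g (Real.exp u)| * Real.exp (-2 * u)

lemma wf_nonneg (g : ArithmeticFunction ℝ) (u : ℝ) : 0 ≤ wf g u := by unfold wf; positivity

lemma Tf_eq (g : ArithmeticFunction ℝ) (x : ℝ) :
    Tf g x = (∑ n ∈ Finset.Ioc 0 ⌊x⌋₊, g n) * x - ∑ n ∈ Finset.Ioc 0 ⌊x⌋₊, g n * n := by
  unfold Tf; rw [Finset.sum_mul, ← Finset.sum_sub_distrib]
  exact Finset.sum_congr rfl fun n _ => by ring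

lemma Tf_meas (g : ArithmeticFunction ℝ) : Measurable (Tf g) := by
  have h1 : Measurable (fun n : ℕ => ∑ n ∈ Finset.Ioc 0 n, g n) := measurable_from_nat
  have h2 : Measurable (fun n : ℕ => ∑ n ∈ Finset.Ioc 0 n, g n * n) := measurable_from_nat
  have h3 := ((h1.comp Nat.measurable_floor).mul measurable_id (M := ℝ)).sub (h2.comp Nat.measurable_floor)
  have e : Tf g = _ := funext (Tf_eq g)
  rw [e]
  exact h3

lemma wf_meas (g : ArithmeticFunction ℝ) : Measurable (wf g) := by
  unfold wf
  have := (Tf_meas g).comp Real.measurable_exp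
  exact (measurable_norm.comp this).mul (by fun_prop)

lemma mem_floor {x : ℝ} {n : ℕ} (hx : 0 ≤ x) (hn : n ∈ Finset.Ioc 0 ⌊x⌋₊) : (0:ℝ) < n ∧ (n:ℝ) ≤ x := by
  rw [Finset.mem_Ioc] at hn
  exact ⟨by exact_mod_cast hn.1, (Nat.le_floor_iff hx).mp hn.2⟩

lemma Tf_bd (h : Sys r g Lm c C d) {x : ℝ} (hx : 0 ≤ x) : |Tf g x| ≤ C * x ^ 2 := by
  have h1 := h.bd x hx
  calc |Tf g x| ≤ ∑ n ∈ Finset.Ioc 0 ⌊x⌋₊, |g n * (x - n)| := Finset.abs_sum_le_sum_abs _ _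
    _ ≤ ∑ n ∈ Finset.Ioc 0 ⌊x⌋₊, r n * x := by
      refine Finset.sum_le_sum fun n hn => ?_
      obtain ⟨a, b⟩ := mem_floor hx hn
      rw [abs_mul, abs_of_nonneg (by linarith : 0 ≤ x - n)]
      exact mul_le_mul (h.g_le n) (by linarith) (by linarith) (h.r_nonneg n)
    _ = (∑ n ∈ Finset.Ioc 0 ⌊x⌋₊, r n) * x := by rw [Finset.sum_mul]
    _ ≤ C * x * x := by gcongr
    _ = _ := by ring

lemma wf_bd (h : Sys r g Lm c C d) (u : ℝ) : wf g u ≤ C := by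
  have h1 := h.Tf_bd (Real.exp_pos u).le
  unfold wf
  calc _ ≤ C * Real.exp u ^ 2 * Real.exp (-2 * u) := by gcongr
    _ = C := by
      rw [← Real.exp_nat_mul, mul_assoc, ← Real.exp_add]; simp

lemma logsum (h : Sys r g Lm c C d) (k : ℕ) : ∀ x : ℝ, 0 < x → x < 2 ^ k →
    ∑ n ∈ Finset.Ioc 0 ⌊x⌋₊, r n * Real.log (x / n) ≤ 2 * C * x := by
  have hC := h.C_pos
  induction k with
  | zero =>
    intro x hx hx1
    have : ⌊x⌋₊ = 0 := by rw [Nat.floor_eq_zero]; simpa using hx1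
    rw [this]; simp; positivity
  | succ k ih =>
    intro x hx hx1
    have h1 := ih (x / 2) (by linarith) (by rw [pow_succ] at hx1; linarith)
    have h2 := h.bd x hx.le
    have hl : Real.log 2 ≤ 1 := by have := Real.log_two_lt_d9; linarith
    have hl0 : 0 ≤ Real.log 2 := Real.log_nonneg (by norm_num)
    have hsub : Finset.Ioc 0 ⌊x/2⌋₊ ⊆ Finset.Ioc 0 ⌊x⌋₊ := by
      refine Finset.Ioc_subset_Ioc_right (Nat.floor_le_floor (by linarith))
    calc _ ≤ ∑ n ∈ Finset.Ioc 0 ⌊x⌋₊, (r n + if n ∈ Finset.Ioc 0 ⌊x/2⌋₊ then r n * Real.log (x / 2 / n) else 0) := by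
          refine Finset.sum_le_sum fun n hn => ?_
          obtain ⟨a, b⟩ := mem_floor hx.le hn
          have hr := h.r_nonneg n
          split_ifs with hm
          · have : Real.log (x / n) = Real.log 2 + Real.log (x / 2 / n) := by
              rw [← Real.log_mul (by norm_num) (by positivity)]; congr 1; field_simp
            rw [this]; nlinarith
          · have : x / 2 < n := by
              by_contra hc
              push Not at hc
              exact hm (Finset.mem_Ioc.mpr ⟨by exact_mod_cast a, Nat.le_floor hc⟩)
            have : Real.log (x / n) ≤ Real.log 2 := by
              refine Real.log_le_log (by positivity) ?_
              rw [div_le_iff₀ a]; linarith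
            nlinarith
      _ = (∑ n ∈ Finset.Ioc 0 ⌊x⌋₊, r n) + ∑ n ∈ Finset.Ioc 0 ⌊x/2⌋₊, r n * Real.log (x / 2 / n) := by
          rw [Finset.sum_add_distrib, Finset.sum_ite_mem, Finset.inter_eq_right.mpr hsub]
      _ ≤ C * x + 2 * C * (x / 2) := by gcongr
      _ = _ := by ring

lemma E_bd (h : Sys r g Lm c C d) {x : ℝ} (hx : 0 < x) :
    |Tf g x * Real.log x - L1 g x| ≤ 2 * C * x ^ 2 := by
  obtain ⟨k, hk⟩ := pow_unbounded_of_one_lt x (one_lt_two)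
  have h1 := h.logsum k x hx hk
  have e : Tf g x * Real.log x - L1 g x = ∑ n ∈ Finset.Ioc 0 ⌊x⌋₊, g n * (x - n) * Real.log (x / n) := by
    unfold Tf L1
    rw [Finset.sum_mul, ← Finset.sum_sub_distrib]
    refine Finset.sum_congr rfl fun n hn => ?_
    obtain ⟨a, b⟩ := mem_floor hx.le hn
    rw [Real.log_div hx.ne' a.ne']; ring
  rw [e]
  calc _ ≤ ∑ n ∈ Finset.Ioc 0 ⌊x⌋₊, |g n * (x - n) * Real.log (x / n)| := Finset.abs_sum_le_sum_abs _ _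
    _ ≤ ∑ n ∈ Finset.Ioc 0 ⌊x⌋₊, x * (r n * Real.log (x / n)) := by
      refine Finset.sum_le_sum fun n hn => ?_
      obtain ⟨a, b⟩ := mem_floor hx.le hn
      have hl : 0 ≤ Real.log (x / n) := Real.log_nonneg (by rw [le_div_iff₀ a]; linarith)
      rw [abs_mul, abs_mul, abs_of_nonneg hl, abs_of_nonneg (by linarith : 0 ≤ x - n), ← mul_assoc]
      refine mul_le_mul_of_nonneg_right ?_ hl
      rw [mul_comm x]
      exact mul_le_mul (h.g_le n) (by linarith) (by linarith) (h.r_nonneg n)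
    _ = x * ∑ n ∈ Finset.Ioc 0 ⌊x⌋₊, r n * Real.log (x / n) := by rw [Finset.mul_sum]
    _ ≤ x * (2 * C * x) := by gcongr
    _ = _ := by ring

/-- pointwise bound. -/
lemma uw_le (h : Sys r g Lm c C d) {u : ℝ} (hu : 0 ≤ u) :
    u * wf g u ≤ |L1 g (Real.exp u)| * Real.exp (-2 * u) + 2 * C := by
  have h1 := h.E_bd (Real.exp_pos u)
  rw [Real.log_exp] at h1
  have h2 : |Tf g (Real.exp u) * u| ≤ |L1 g (Real.exp u)| + 2 * C * Real.exp u ^ 2 := by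
    have := abs_sub_abs_le_abs_sub (Tf g (Real.exp u) * u) (L1 g (Real.exp u))
    linarith
  rw [abs_mul, abs_of_nonneg hu] at h2
  unfold wf
  have e : Real.exp u ^ 2 * Real.exp (-2 * u) = 1 := by
    rw [← Real.exp_nat_mul, ← Real.exp_add]; simp
  calc _ = |Tf g (Real.exp u)| * u * Real.exp (-2 * u) := by ring
    _ ≤ (|L1 g (Real.exp u)| + 2 * C * Real.exp u ^ 2) * Real.exp (-2 * u) := by gcongr
    _ = |L1 g (Real.exp u)| * Real.exp (-2 * u) + 2 * C * (Real.exp u ^ 2 * Real.exp (-2 * u)) := by ring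
    _ = _ := by rw [e]; ring

lemma u2w2_le (h : Sys r g Lm c C d) {u U : ℝ} (hu : 0 ≤ u) (hU : u ≤ U) (hU0 : 0 < U) :
    (u * wf g u) ^ 2 ≤ 18 * (Real.exp (-(2 + 1 / U) * u) * L1 g (Real.exp u)) ^ 2 + 8 * C ^ 2 := by
  have h1 := h.uw_le hu
  have h2 : Real.exp (-2 * u) ≤ 3 * Real.exp (-(2 + 1 / U) * u) := by
    have e : Real.exp (-2 * u) = Real.exp (u / U) * Real.exp (-(2 + 1 / U) * u) := by
      rw [← Real.exp_add]; congr 1; field_simp; ring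
    rw [e]
    gcongr
    have : u / U ≤ 1 := by rw [div_le_one hU0]; exact hU
    calc Real.exp (u / U) ≤ Real.exp 1 := Real.exp_le_exp.mpr this
      _ ≤ 3 := by have := Real.exp_one_lt_d9; linarith
  have h3 : u * wf g u ≤ 3 * |Real.exp (-(2 + 1 / U) * u) * L1 g (Real.exp u)| + 2 * C := by
    refine h1.trans ?_
    rw [abs_mul, abs_of_pos (Real.exp_pos _)]
    have := mul_le_mul_of_nonneg_left h2 (abs_nonneg (L1 g (Real.exp u)))
    linarith
  have h0 : 0 ≤ u * wf g u := mul_nonneg hu (wf_nonneg g u)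
  set y := |Real.exp (-(2 + 1 / U) * u) * L1 g (Real.exp u)| with hy
  rw [← sq_abs (Real.exp (-(2 + 1 / U) * u) * L1 g (Real.exp u)), ← hy]
  have : (u * wf g u) ^ 2 ≤ (3 * y + 2 * C) ^ 2 := by gcongr
  nlinarith [sq_nonneg (3 * y - 2 * C)]

open MeasureTheory in
lemma wf_ii (h : Sys r g Lm c C d) (a b : ℝ) : IntervalIntegrable (wf g) volume a b := by
  refine (intervalIntegrable_const (c := C)).mono_fun (wf_meas g).aestronglyMeasurable
    (Eventually.of_forall fun u => ?_)
  beta_reduce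
  rw [Real.norm_of_nonneg (wf_nonneg g u), Real.norm_of_nonneg h.C_pos.le]
  exact h.wf_bd u

open MeasureTheory in
lemma int_w (h : Sys r g Lm c C d) {ε : ℝ} (hε : 0 < ε) : ∃ U0 > 0, ∀ U : ℝ, U0 ≤ U →
    ∫ u in (0:ℝ)..U, wf g u ≤ ε * U := by
  have hC := h.C_pos
  set η := min (1/2) (ε / (3 * (C + 1))) with hη
  have hηp : 0 < η := by positivity
  have hη1 : η ≤ 1 / 2 := min_le_left _ _
  have hη2 : η * (C + 1) ≤ ε / 3 := by
    have : η ≤ ε / (3 * (C + 1)) := min_le_right _ _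
    calc η * (C + 1) ≤ ε / (3 * (C + 1)) * (C + 1) := by gcongr
      _ = ε / 3 := by field_simp
  obtain ⟨δ0, hδ0, hD⟩ := h.lemmaD (ε := ε * η ^ 3 / 54) (by positivity)
  refine ⟨max (max 1 (2 / δ0)) (24 * C ^ 2 / (η ^ 3 * ε)), by positivity, fun U hU => ?_⟩
  simp only [max_le_iff] at hU
  obtain ⟨⟨hU1, hU2⟩, hU3⟩ := hU
  have hUp : 0 < U := by linarith
  obtain ⟨i1, i2⟩ := hD (1 / U) (by positivity) (by
    rw [div_lt_iff₀ hUp]; rw [div_le_iff₀ hδ0] at hU2; linarith)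
  set f := fun u : ℝ => (Real.exp (-(2 + 1 / U) * u) * L1 g (Real.exp u)) ^ 2 with hf
  have hηU : η * U ≤ U := by nlinarith
  rw [← intervalIntegral.integral_add_adjacent_intervals (h.wf_ii 0 (η * U)) (h.wf_ii (η * U) U)]
  have a1 : ∫ u in (0:ℝ)..(η * U), wf g u ≤ C * (η * U) := by
    have := intervalIntegral.integral_mono_on (by positivity : (0:ℝ) ≤ η * U) (h.wf_ii 0 (η * U))
      (intervalIntegrable_const (c := C)) fun u _ => h.wf_bd u
    rw [intervalIntegral.integral_const] at this
    simpa [mul_comm] using this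
  have a2 : ∫ u in (η * U)..U, wf g u ≤ ∫ u in (η * U)..U, ((η + 8 * C ^ 2 / (η ^ 3 * U ^ 2)) + 18 / (η ^ 3 * U ^ 2) * f u) := by
    refine intervalIntegral.integral_mono_on hηU (h.wf_ii _ _)
      (intervalIntegrable_const.add (i1.intervalIntegrable.const_mul _)) fun u hu => ?_
    have hu0 : 0 < u := lt_of_lt_of_le (by positivity) hu.1
    have h1 := h.u2w2_le hu0.le hu.2 hUp
    have hw := wf_nonneg g u
    have hfu : 0 ≤ f u := by simp only [hf]; positivity
    rcases le_total (wf g u) η with hwη | hwη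
    · have : 0 ≤ 8 * C ^ 2 / (η ^ 3 * U ^ 2) + 18 / (η ^ 3 * U ^ 2) * f u := by positivity
      linarith
    · have h2 : wf g u * (η ^ 3 * U ^ 2) ≤ (u * wf g u) ^ 2 := by
        have := hu.1
        calc wf g u * (η ^ 3 * U ^ 2) = wf g u * η * (η * U) ^ 2 := by ring
          _ ≤ wf g u * wf g u * u ^ 2 := by gcongr
          _ = _ := by ring
      have h3 : wf g u ≤ (18 * f u + 8 * C ^ 2) / (η ^ 3 * U ^ 2) := by
        rw [le_div_iff₀ (by positivity)]
        exact h2.trans h1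
      have e : (18 * f u + 8 * C ^ 2) / (η ^ 3 * U ^ 2) = 8 * C ^ 2 / (η ^ 3 * U ^ 2) + 18 / (η ^ 3 * U ^ 2) * f u := by ring
      linarith
  rw [intervalIntegral.integral_add intervalIntegrable_const (i1.intervalIntegrable.const_mul _),
    intervalIntegral.integral_const, intervalIntegral.integral_const_mul] at a2
  have a3 : ∫ u in (η * U)..U, f u ≤ ε * η ^ 3 / 54 / (1 / U) ^ 3 := by
    rw [intervalIntegral.integral_of_le hηU]
    exact (setIntegral_le_integral i1 (Eventually.of_forall fun u => by simp only [hf]; positivity)).trans i2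
  have a4 : 18 / (η ^ 3 * U ^ 2) * ∫ u in (η * U)..U, f u ≤ ε / 3 * U := by
    calc _ ≤ 18 / (η ^ 3 * U ^ 2) * (ε * η ^ 3 / 54 / (1 / U) ^ 3) := by gcongr
      _ = _ := by field_simp; ring
  have a5 : 8 * C ^ 2 / (η ^ 3 * U ^ 2) ≤ ε / 3 := by
    rw [div_le_iff₀ (by positivity)]
    rw [div_le_iff₀ (by positivity)] at hU3
    have : U * (η ^ 3 * ε) ≤ U ^ 2 * (η ^ 3 * ε) := by
      gcongr; nlinarith
    linarith
  have a6 : (U - η * U) • (η + 8 * C ^ 2 / (η ^ 3 * U ^ 2)) ≤ U * (η + ε / 3) := by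
    rw [smul_eq_mul]
    gcongr
    have : 0 < η * U := by positivity
    linarith
  calc _ ≤ C * (η * U) + (U * (η + ε / 3) + ε / 3 * U) := by linarith
    _ = (η * (C + 1)) * U + (ε / 3 + ε / 3) * U := by ring
    _ ≤ (ε / 3) * U + (ε / 3 + ε / 3) * U := by gcongr
    _ = _ := by ring

end Sys
namespace Sys
variable {r g Lm : ArithmeticFunction ℝ} {c C d : ℝ}

/-- the identity arithmetic function -/
def nid : ArithmeticFunction ℝ := ⟨fun n => (n : ℝ), by simp⟩

lemma nid_apply (n : ℕ) : nid n = (n : ℝ) := rfl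

lemma pmul_nid (f g : ArithmeticFunction ℝ) : (f * g).pmul nid = f.pmul nid * g.pmul nid := by
  ext n
  simp only [ArithmeticFunction.pmul_apply, ArithmeticFunction.mul_apply, nid_apply]
  rw [Finset.sum_mul]
  refine Finset.sum_congr rfl fun p hp => ?_
  rw [Nat.mem_divisorsAntidiagonal] at hp
  rw [← hp.1]; push_cast; ring

lemma conv_T (f g : ArithmeticFunction ℝ) (x : ℝ) :
    Tf (f * g) x = ∑ m ∈ Finset.Ioc 0 ⌊x⌋₊, f m * (m * Tf g (x / m)) := by
  rw [Tf_eq]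
  have h1 : ∑ n ∈ Finset.Ioc 0 ⌊x⌋₊, (f * g) n * n
      = ∑ n ∈ Finset.Ioc 0 ⌊x⌋₊, (f.pmul nid * g.pmul nid) n := by
    refine Finset.sum_congr rfl fun n _ => ?_
    rw [← pmul_nid]; rfl
  rw [h1, ArithmeticFunction.sum_Ioc_mul_eq_sum_sum, ArithmeticFunction.sum_Ioc_mul_eq_sum_sum,
    Finset.sum_mul, ← Finset.sum_sub_distrib]
  refine Finset.sum_congr rfl fun m hm => ?_
  have hm0 : (m : ℝ) ≠ 0 := by
    rw [Finset.mem_Ioc] at hm; exact_mod_cast hm.1.ne'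
  rw [Tf_eq, Nat.floor_div_natCast]
  simp only [ArithmeticFunction.pmul_apply, nid_apply]
  field_simp

lemma L1_eq (h : Sys r g Lm c C d) (x : ℝ) : L1 g x = - Tf (Lm * g) x := by
  have : Lm * g = - g.pmul ArithmeticFunction.log := by rw [h.glog, neg_neg]
  rw [this]
  unfold L1 Tf
  rw [← Finset.sum_neg_distrib]
  refine Finset.sum_congr rfl fun n _ => ?_
  rw [show (-g.pmul ArithmeticFunction.log) n = -(g.pmul ArithmeticFunction.log n) from rfl]
  simp [ArithmeticFunction.pmul_apply, ArithmeticFunction.log_apply]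

lemma wf_neg (g : ArithmeticFunction ℝ) {u : ℝ} (hu : u < 0) : wf g u = 0 := by
  have : ⌊Real.exp u⌋₊ = 0 := by
    rw [Nat.floor_eq_zero, ← Real.exp_zero]; exact Real.exp_lt_exp.mpr hu
  unfold wf Tf
  rw [this]; simp

lemma Vw_le (h : Sys r g Lm c C d) {V W : ℝ} (hV : 0 ≤ V) (hW : V ≤ W) :
    V * wf g V ≤ ∑ m ∈ Finset.Ioc 0 ⌊Real.exp W⌋₊, Lm m / m * wf g (V - Real.log m) + 2 * C := by
  refine (h.uw_le hV).trans ?_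
  gcongr
  have hsub : Finset.Ioc 0 ⌊Real.exp V⌋₊ ⊆ Finset.Ioc 0 ⌊Real.exp W⌋₊ :=
    Finset.Ioc_subset_Ioc_right (Nat.floor_le_floor (Real.exp_le_exp.mpr hW))
  calc |L1 g (Real.exp V)| * Real.exp (-2 * V)
      ≤ (∑ m ∈ Finset.Ioc 0 ⌊Real.exp V⌋₊, |Lm m * (m * Tf g (Real.exp V / m))|) * Real.exp (-2 * V) := by
        rw [h.L1_eq, abs_neg, conv_T]
        gcongr
        exact Finset.abs_sum_le_sum_abs _ _
    _ = ∑ m ∈ Finset.Ioc 0 ⌊Real.exp V⌋₊, Lm m / m * wf g (V - Real.log m) := by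
        rw [Finset.sum_mul]
        refine Finset.sum_congr rfl fun m hm => ?_
        obtain ⟨a, b⟩ := mem_floor (Real.exp_pos V).le hm
        rw [abs_mul, abs_mul, abs_of_nonneg (h.Lm_nonneg m), abs_of_pos a]
        unfold wf
        rw [Real.exp_sub, Real.exp_log a]
        have : Real.exp (-2 * (V - Real.log m)) = Real.exp (-2 * V) * (m:ℝ) ^ 2 := by
          rw [← Real.exp_log a, ← Real.exp_nat_mul, ← Real.exp_add, Real.exp_log a]
          congr 1; push_cast; ring
        rw [this]
        field_simp
    _ ≤ _ := by
        refine Finset.sum_le_sum_of_subset_of_nonneg hsub fun m _ _ => ?_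
        exact mul_nonneg (div_nonneg (h.Lm_nonneg m) (by positivity)) (wf_nonneg _ _)

open MeasureTheory in
lemma swap (h : Sys r g Lm c C d) {U η : ℝ} (hU : 0 ≤ U) (hη : 0 < η) (hη1 : η ≤ 1) :
    ∑ m ∈ Finset.Ioc 0 ⌊Real.exp (U + η)⌋₊, Lm m / m * ∫ V in U..(U + η), wf g (V - Real.log m)
      ≤ 18 * d * ∫ v in (0:ℝ)..(U + η), wf g v := by
  have hd := h.d_nonneg
  set Ms := Finset.Ioc 0 ⌊Real.exp (U + η)⌋₊ with hMs
  let I : ℕ → Set ℝ := fun m => Set.Ioc (U - Real.log m) (U + η - Real.log m)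
  have hInt : ∀ m, Integrable ((I m).indicator (wf g)) := by
    intro m
    rw [integrable_indicator_iff measurableSet_Ioc]
    exact (intervalIntegrable_iff_integrableOn_Ioc_of_le (by linarith)).mp (h.wf_ii _ _)
  have e1 : ∀ m : ℕ, ∫ V in U..(U + η), wf g (V - Real.log m) = ∫ v, (I m).indicator (wf g) v := by
    intro m
    rw [intervalIntegral.integral_comp_sub_right (fun v => wf g v), integral_indicator measurableSet_Ioc,
      intervalIntegral.integral_of_le (by linarith)]
  simp only [e1, ← integral_const_mul]
  rw [← integral_finsetSum _ (fun m _ => (hInt m).const_mul _)]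
  rw [intervalIntegral.integral_of_le (by linarith), ← integral_Icc_eq_integral_Ioc,
    ← integral_indicator measurableSet_Icc, ← integral_const_mul]
  have hi0 : Integrable ((Set.Icc 0 (U + η)).indicator (wf g)) := by
    rw [integrable_indicator_iff measurableSet_Icc, integrableOn_Icc_iff_integrableOn_Ioc]
    exact (intervalIntegrable_iff_integrableOn_Ioc_of_le (by linarith)).mp (h.wf_ii _ _)
  refine integral_mono (integrable_finsetSum _ fun m _ => (hInt m).const_mul _) (hi0.const_mul _) fun v => ?_
  beta_reduce
  have hw := wf_nonneg g v
  rcases lt_or_ge v 0 with hv | hv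
  · have z : wf g v = 0 := wf_neg g hv
    have z1 : ∀ s : Set ℝ, s.indicator (wf g) v = 0 := by
      intro s; simp [Set.indicator, z]
    simp [z1]
  have e2 : ∀ m, (I m).indicator (wf g) v = (if v ∈ I m then 1 else 0) * wf g v := by
    intro m; simp [Set.indicator]
  simp only [e2, ← mul_assoc]
  rw [← Finset.sum_mul]
  rcases lt_or_ge (U + η) v with hv2 | hv2
  · have : ∑ m ∈ Ms, Lm m / m * (if v ∈ I m then (1:ℝ) else 0) = 0 := by
      refine Finset.sum_eq_zero fun m hm => ?_
      rw [if_neg, mul_zero]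
      intro hvI
      have := hvI.2
      have : 0 ≤ Real.log m := Real.log_natCast_nonneg m
      linarith
    rw [this, zero_mul]
    refine mul_nonneg (by positivity) (Set.indicator_nonneg (fun u _ => wf_nonneg g u) v)
  rw [Set.indicator_of_mem (show v ∈ Set.Icc 0 (U + η) from ⟨hv, hv2⟩)]
  refine mul_le_mul_of_nonneg_right ?_ hw
  have hsub : Finset.Ioc 0 ⌊Real.exp (U + η - v)⌋₊ ⊆ Ms :=
    Finset.Ioc_subset_Ioc_right (Nat.floor_le_floor (Real.exp_le_exp.mpr (by linarith)))
  calc ∑ m ∈ Ms, Lm m / m * (if v ∈ I m then (1:ℝ) else 0)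
      ≤ ∑ m ∈ Ms, if m ∈ Finset.Ioc 0 ⌊Real.exp (U + η - v)⌋₊ then Real.exp (v - U) * Lm m else 0 := by
        refine Finset.sum_le_sum fun m hm => ?_
        obtain ⟨a, b⟩ := mem_floor (Real.exp_pos _).le hm
        by_cases hvI : v ∈ I m
        · have h1 := hvI.1
          have h2 := hvI.2
          have hm2 : m ∈ Finset.Ioc 0 ⌊Real.exp (U + η - v)⌋₊ := by
            refine Finset.mem_Ioc.mpr ⟨by exact_mod_cast a, Nat.le_floor ?_⟩
            rw [← Real.log_le_iff_le_exp a]; linarith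
          rw [if_pos hvI, if_pos hm2, mul_one, div_eq_mul_inv, mul_comm]
          refine mul_le_mul_of_nonneg_right ?_ (h.Lm_nonneg m)
          rw [← Real.exp_log a, ← Real.exp_neg]
          refine Real.exp_le_exp.mpr ?_
          linarith
        · rw [if_neg hvI, mul_zero]
          split_ifs
          · exact mul_nonneg (Real.exp_pos _).le (h.Lm_nonneg m)
          · exact le_rfl
    _ = Real.exp (v - U) * ∑ m ∈ Finset.Ioc 0 ⌊Real.exp (U + η - v)⌋₊, Lm m := by
        rw [Finset.sum_ite_mem, Finset.inter_eq_right.mpr hsub, Finset.mul_sum]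
    _ ≤ Real.exp (v - U) * (6 * d * Real.exp (U + η - v)) := by
        gcongr
        exact h.psiL_le (Real.exp_pos _).le
    _ = 6 * d * Real.exp η := by
        rw [show Real.exp (v - U) * (6 * d * Real.exp (U + η - v)) = 6 * d * (Real.exp (v - U) * Real.exp (U + η - v)) by ring,
          ← Real.exp_add]
        congr 2; ring
    _ ≤ 6 * d * 3 := by
        gcongr
        calc Real.exp η ≤ Real.exp 1 := Real.exp_le_exp.mpr hη1
          _ ≤ 3 := by have := Real.exp_one_lt_d9; linarith
    _ = _ := by ring

open MeasureTheory in
lemma avg (h : Sys r g Lm c C d) {U η : ℝ} (hU : 0 < U) (hη : 0 < η) (hη1 : η ≤ 1) :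
    U * ∫ V in U..(U + η), wf g V ≤ 18 * d * (∫ v in (0:ℝ)..(U + η), wf g v) + 2 * C := by
  have hC := h.C_pos
  have iw : ∀ m : ℕ, IntervalIntegrable (fun V => wf g (V - Real.log m)) volume U (U + η) := by
    intro m
    have := (h.wf_ii (U - Real.log m) (U + η - Real.log m)).comp_sub_right (Real.log m)
    simpa using this
  calc U * ∫ V in U..(U + η), wf g V = ∫ V in U..(U + η), U * wf g V := by
        rw [intervalIntegral.integral_const_mul]
    _ ≤ ∫ V in U..(U + η), (∑ m ∈ Finset.Ioc 0 ⌊Real.exp (U + η)⌋₊, Lm m / m * wf g (V - Real.log m) + 2 * C) := by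
        refine intervalIntegral.integral_mono_on (by linarith) ((h.wf_ii _ _).const_mul _)
          (IntervalIntegrable.add ?_ intervalIntegrable_const) fun V hV => ?_
        · have := IntervalIntegrable.sum (μ := volume) (a := U) (b := U + η) (Finset.Ioc 0 ⌊Real.exp (U + η)⌋₊)
            (f := fun m V => Lm m / m * wf g (V - Real.log m)) (fun m _ => (iw m).const_mul _)
          have e : (fun V => ∑ m ∈ Finset.Ioc 0 ⌊Real.exp (U + η)⌋₊, Lm m / m * wf g (V - Real.log m)) =
              ∑ m ∈ Finset.Ioc 0 ⌊Real.exp (U + η)⌋₊, (fun V => Lm m / m * wf g (V - Real.log m)) := by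
            ext V; rw [Finset.sum_apply]
          rw [e]
          exact this
        · have h1 := h.Vw_le (V := V) (W := U + η) (by linarith [hV.1]) hV.2
          have h2 := wf_nonneg g V
          have := hV.1
          nlinarith
    _ = (∑ m ∈ Finset.Ioc 0 ⌊Real.exp (U + η)⌋₊, Lm m / m * ∫ V in U..(U + η), wf g (V - Real.log m)) + η * (2 * C) := by
        rw [intervalIntegral.integral_add ?_ intervalIntegrable_const, intervalIntegral.integral_const,
          intervalIntegral.integral_finsetSum (fun m _ => (iw m).const_mul _)]
        · simp only [intervalIntegral.integral_const_mul, smul_eq_mul]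
          ring
        · have := IntervalIntegrable.sum (μ := volume) (a := U) (b := U + η) (Finset.Ioc 0 ⌊Real.exp (U + η)⌋₊)
            (f := fun m V => Lm m / m * wf g (V - Real.log m)) (fun m _ => (iw m).const_mul _)
          have e : (fun V => ∑ m ∈ Finset.Ioc 0 ⌊Real.exp (U + η)⌋₊, Lm m / m * wf g (V - Real.log m)) =
              ∑ m ∈ Finset.Ioc 0 ⌊Real.exp (U + η)⌋₊, (fun V => Lm m / m * wf g (V - Real.log m)) := by
            ext V; rw [Finset.sum_apply]
          rw [e]
          exact this
    _ ≤ _ := by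
        have := h.swap (U := U) hU.le hη hη1
        nlinarith

lemma Tf_max (g : ArithmeticFunction ℝ) {x y : ℝ} (hx : 0 ≤ x) (hxy : x ≤ y) :
    Tf g x = ∑ n ∈ Finset.Ioc 0 ⌊y⌋₊, g n * max (x - n) 0 := by
  have hsub : Finset.Ioc 0 ⌊x⌋₊ ⊆ Finset.Ioc 0 ⌊y⌋₊ :=
    Finset.Ioc_subset_Ioc_right (Nat.floor_le_floor hxy)
  rw [← Finset.sum_subset hsub]
  · unfold Tf
    refine Finset.sum_congr rfl fun n hn => ?_
    obtain ⟨a, b⟩ := mem_floor hx hn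
    rw [max_eq_left (by linarith)]
  · intro n hn hn'
    rw [Finset.mem_Ioc] at hn
    rw [Finset.mem_Ioc, not_and, Nat.le_floor_iff hx, not_le] at hn'
    rw [max_eq_right (by linarith [hn' hn.1]), mul_zero]

lemma Tf_lip (h : Sys r g Lm c C d) {x y : ℝ} (hx : 0 ≤ x) (hxy : x ≤ y) :
    |Tf g y - Tf g x| ≤ C * y * (y - x) := by
  rw [Tf_max g (hx.trans hxy) le_rfl, Tf_max g hx hxy, ← Finset.sum_sub_distrib]
  calc _ ≤ ∑ n ∈ Finset.Ioc 0 ⌊y⌋₊, |g n * max (y - n) 0 - g n * max (x - n) 0| := Finset.abs_sum_le_sum_abs _ _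
    _ ≤ ∑ n ∈ Finset.Ioc 0 ⌊y⌋₊, r n * (y - x) := by
      refine Finset.sum_le_sum fun n _ => ?_
      rw [← mul_sub, abs_mul]
      refine mul_le_mul (h.g_le n) ?_ (abs_nonneg _) (h.r_nonneg n)
      have := abs_max_sub_max_le_abs (y - n) (x - n) 0
      rw [show y - (n:ℝ) - (x - n) = y - x by ring, abs_of_nonneg (by linarith : 0 ≤ y - x)] at this
      exact this
    _ = (∑ n ∈ Finset.Ioc 0 ⌊y⌋₊, r n) * (y - x) := by rw [Finset.sum_mul]
    _ ≤ _ := by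
      have := h.bd y (hx.trans hxy)
      have : 0 ≤ y - x := by linarith
      gcongr

lemma wf_lip (h : Sys r g Lm c C d) {U V η : ℝ} (hη1 : η ≤ 1) (hV : U ≤ V) (hV2 : V ≤ U + η) :
    wf g U ≤ wf g V + 32 * C * η := by
  have hC := h.C_pos
  have hη : 0 ≤ η := by linarith
  have h1 := h.Tf_lip (Real.exp_pos U).le (Real.exp_le_exp.mpr hV)
  have h2 : |Tf g (Real.exp U)| ≤ |Tf g (Real.exp V)| + C * Real.exp V * (Real.exp V - Real.exp U) := by
    have := abs_sub_abs_le_abs_sub (Tf g (Real.exp U)) (Tf g (Real.exp V))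
    rw [abs_sub_comm] at this
    linarith
  have h3 : Real.exp (2 * (V - U)) ≤ 1 + 16 * η := by
    have a1 : Real.exp (2 * (V - U)) ≤ Real.exp (2 * η) := Real.exp_le_exp.mpr (by linarith)
    have a2 := Real.add_one_le_exp (-(2 * η))
    have a3 : Real.exp (2 * η) * Real.exp (-(2 * η)) = 1 := by rw [← Real.exp_add]; simp
    have a4 : Real.exp (2 * η) ≤ 8 := by
      calc Real.exp (2 * η) ≤ Real.exp (2 * 1) := Real.exp_le_exp.mpr (by linarith)
        _ = Real.exp 1 ^ 2 := by rw [← Real.exp_nat_mul]; norm_num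
        _ ≤ 2.7182818286 ^ 2 := by gcongr; exact Real.exp_one_lt_d9.le
        _ ≤ 8 := by norm_num
    have a5 := Real.exp_pos (2 * η)
    nlinarith
  have e1 : Real.exp (-2 * U) = Real.exp (2 * (V - U)) * Real.exp (-2 * V) := by
    rw [← Real.exp_add]; congr 1; ring
  have e2 : Real.exp V * Real.exp V * Real.exp (-2 * U) = Real.exp (2 * (V - U)) := by
    rw [← Real.exp_add, ← Real.exp_add]; congr 1; ring
  have e3 : 1 ≤ Real.exp V * Real.exp U * Real.exp (-2 * U) := by
    rw [← Real.exp_add, ← Real.exp_add]; exact Real.one_le_exp (by linarith)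
  have hwV := h.wf_bd V
  have hwV0 := wf_nonneg g V
  calc wf g U ≤ (|Tf g (Real.exp V)| + C * Real.exp V * (Real.exp V - Real.exp U)) * Real.exp (-2 * U) := by
        unfold wf; gcongr
    _ = |Tf g (Real.exp V)| * Real.exp (-2 * U) + C * (Real.exp V * Real.exp V * Real.exp (-2 * U) - Real.exp V * Real.exp U * Real.exp (-2 * U)) := by ring
    _ ≤ |Tf g (Real.exp V)| * Real.exp (-2 * U) + C * (1 + 16 * η - 1) := by
        rw [e2]; gcongr
    _ = wf g V * Real.exp (2 * (V - U)) + 16 * C * η := by unfold wf; rw [e1]; ring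
    _ ≤ wf g V * (1 + 16 * η) + 16 * C * η := by gcongr
    _ ≤ _ := by nlinarith

open MeasureTheory in
lemma wf_tendsto (h : Sys r g Lm c C d) : Tendsto (wf g) atTop (nhds 0) := by
  have hC := h.C_pos
  have hd := h.d_nonneg
  rw [Metric.tendsto_atTop]
  intro ε hε
  set η := min 1 (ε / (128 * C)) with hη
  have hηp : 0 < η := by positivity
  have hη1 : η ≤ 1 := min_le_left _ _
  have hη2 : 32 * C * η ≤ ε / 4 := by
    have : η ≤ ε / (128 * C) := min_le_right _ _
    calc 32 * C * η ≤ 32 * C * (ε / (128 * C)) := by gcongr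
      _ = ε / 4 := by field_simp; norm_num
  obtain ⟨U0, hU0, hw⟩ := h.int_w (ε := ε * η / (144 * (d + 1))) (by positivity)
  refine ⟨max (max U0 1) (16 * C / (ε * η)), fun U hU => ?_⟩
  simp only [ge_iff_le, max_le_iff] at hU
  obtain ⟨⟨hU1, hU2⟩, hU3⟩ := hU
  have hUp : 0 < U := by linarith
  rw [Real.dist_eq, sub_zero, abs_of_nonneg (wf_nonneg g U)]
  have h1 := h.avg hUp hηp hη1
  have h2 := hw (U + η) (by linarith)
  have h3 : η * (wf g U - 32 * C * η) ≤ ∫ V in U..(U + η), wf g V := by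
    have := intervalIntegral.integral_mono_on (by linarith : U ≤ U + η) (intervalIntegrable_const (c := wf g U - 32 * C * η))
      (h.wf_ii U (U + η)) fun V hV => by
        have := h.wf_lip hη1 hV.1 hV.2
        linarith
    rw [intervalIntegral.integral_const, smul_eq_mul] at this
    simpa using this
  have h4 : 18 * d * (∫ v in (0:ℝ)..(U + η), wf g v) ≤ ε * η / 4 * U := by
    calc _ ≤ 18 * d * (ε * η / (144 * (d + 1)) * (U + η)) := by gcongr
      _ ≤ 18 * (d + 1) * (ε * η / (144 * (d + 1)) * (2 * U)) := by
          gcongr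
          · linarith
          · linarith
      _ = _ := by field_simp; norm_num
  have h5 : 2 * C ≤ ε * η / 8 * U := by
    rw [div_le_iff₀ (by positivity)] at hU3
    linarith
  have h6 : U * (η * (wf g U - 32 * C * η)) ≤ ε * η / 2 * U := by
    have := mul_le_mul_of_nonneg_left h3 hUp.le
    have : 0 ≤ ε * η * U := by positivity
    linarith
  have h7 : (U * η) * (wf g U - 32 * C * η) ≤ (U * η) * (ε / 2) := by linarith
  have h8 := le_of_mul_le_mul_left h7 (by positivity)
  linarith

lemma Tf_little (h : Sys r g Lm c C d) : Tendsto (fun x : ℝ => |Tf g x| / x ^ 2) atTop (nhds 0) := by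
  have := h.wf_tendsto.comp Real.tendsto_log_atTop
  refine this.congr' ?_
  filter_upwards [eventually_gt_atTop 0] with x hx
  simp only [Function.comp, wf]
  rw [Real.exp_log hx, div_eq_mul_inv]
  congr 1
  rw [show -2 * Real.log x = -(((2:ℕ):ℝ) * Real.log x) by push_cast; ring, Real.exp_neg, Real.exp_nat_mul, Real.exp_log hx]

lemma M_le (h : Sys r g Lm c C d) {x y : ℝ} (hx : 0 ≤ x) (hxy : x < y) :
    |∑ n ∈ Finset.Ioc 0 ⌊x⌋₊, g n| ≤ (|Tf g y| + |Tf g x|) / (y - x) + (Nf r y - Nf r x) := by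
  have hh : 0 < y - x := by linarith
  have hsub : Finset.Ioc 0 ⌊x⌋₊ ⊆ Finset.Ioc 0 ⌊y⌋₊ :=
    Finset.Ioc_subset_Ioc_right (Nat.floor_le_floor hxy.le)
  have e : Tf g y - Tf g x - (y - x) * ∑ n ∈ Finset.Ioc 0 ⌊x⌋₊, g n
      = ∑ n ∈ Finset.Ioc 0 ⌊y⌋₊ \ Finset.Ioc 0 ⌊x⌋₊, g n * (y - n) := by
    have h1 : Tf g y = ∑ n ∈ Finset.Ioc 0 ⌊y⌋₊ \ Finset.Ioc 0 ⌊x⌋₊, g n * (y - n) + ∑ n ∈ Finset.Ioc 0 ⌊x⌋₊, g n * (y - n) :=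
      (Finset.sum_sdiff hsub).symm
    rw [h1]
    unfold Tf
    rw [Finset.mul_sum]
    have : ∑ n ∈ Finset.Ioc 0 ⌊x⌋₊, g n * (y - n) = ∑ n ∈ Finset.Ioc 0 ⌊x⌋₊, g n * (x - n) + ∑ n ∈ Finset.Ioc 0 ⌊x⌋₊, (y - x) * g n := by
      rw [← Finset.sum_add_distrib]; exact Finset.sum_congr rfl fun n _ => by ring
    rw [this]; ring
  have hN : Nf r y - Nf r x = ∑ n ∈ Finset.Ioc 0 ⌊y⌋₊ \ Finset.Ioc 0 ⌊x⌋₊, r n := by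
    unfold Nf; rw [← Finset.sum_sdiff hsub]; ring
  have h2 : |∑ n ∈ Finset.Ioc 0 ⌊y⌋₊ \ Finset.Ioc 0 ⌊x⌋₊, g n * (y - n)| ≤ (y - x) * (Nf r y - Nf r x) := by
    rw [hN, Finset.mul_sum]
    refine (Finset.abs_sum_le_sum_abs _ _).trans (Finset.sum_le_sum fun n hn => ?_)
    rw [Finset.mem_sdiff] at hn
    obtain ⟨a, b⟩ := mem_floor (hx.trans hxy.le) hn.1
    have h3 : x < n := by
      by_contra hc
      push Not at hc
      exact hn.2 (Finset.mem_Ioc.mpr ⟨by exact_mod_cast a, Nat.le_floor hc⟩)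
    rw [abs_mul, abs_of_nonneg (by linarith : 0 ≤ y - n), mul_comm]
    exact mul_le_mul (by linarith) (h.g_le n) (abs_nonneg _) hh.le
  rw [← e] at h2
  have h3 : (y - x) * |∑ n ∈ Finset.Ioc 0 ⌊x⌋₊, g n| ≤ |Tf g y| + |Tf g x| + (y - x) * (Nf r y - Nf r x) := by
    rw [← abs_of_pos hh, ← abs_mul, abs_of_pos hh]
    have a1 := abs_sub_abs_le_abs_sub ((y - x) * ∑ n ∈ Finset.Ioc 0 ⌊x⌋₊, g n) (Tf g y - Tf g x)
    rw [abs_sub_comm ((y - x) * ∑ n ∈ Finset.Ioc 0 ⌊x⌋₊, g n) (Tf g y - Tf g x)] at a1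
    have a2 := abs_sub (Tf g y) (Tf g x)
    linarith
  rw [mul_comm, ← le_div_iff₀ hh] at h3
  refine h3.trans (le_of_eq ?_)
  field_simp

/-- The main analytic theorem. -/
theorem main (h : Sys r g Lm c C d) :
    Tendsto (fun x : ℝ => (∑ n ∈ Finset.Ioc 0 ⌊x⌋₊, g n) / x) atTop (nhds 0) := by
  have hc := h.c_pos
  rw [Metric.tendsto_nhds]
  intro ε hε
  set η := ε / (2 * c) with hη
  have hηp : 0 < η := by positivity
  have hmul : Tendsto (fun x : ℝ => (1 + η) * x) atTop atTop := tendsto_id.const_mul_atTop (by linarith)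
  have t1 := h.Tf_little.comp hmul
  have t2 := h.Tf_little
  have t3 := h.lim.comp hmul
  have t4 := h.lim
  have hlim : Tendsto (fun x : ℝ => (|Tf g ((1 + η) * x)| / ((1 + η) * x) ^ 2 * (1 + η) ^ 2 + |Tf g x| / x ^ 2) / η
      + ((Nf r ((1 + η) * x) / ((1 + η) * x)) * (1 + η) - Nf r x / x)) atTop
      (nhds ((0 * (1 + η) ^ 2 + 0) / η + (c * (1 + η) - c))) :=
    (((t1.mul_const _).add t2).div_const _).add ((t3.mul_const _).sub t4)
  have hval : (0 * (1 + η) ^ 2 + 0) / η + (c * (1 + η) - c) < ε := by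
    have : c * η = ε / 2 := by rw [hη]; field_simp
    simp only [zero_mul, add_zero, zero_div, zero_add]
    linarith
  filter_upwards [hlim.eventually_lt_const hval, eventually_gt_atTop 0] with x hx1 hx
  rw [Real.dist_eq, sub_zero, abs_div, abs_of_pos hx]
  refine lt_of_le_of_lt ?_ hx1
  have := h.M_le (y := (1 + η) * x) hx.le (by nlinarith)
  calc _ ≤ ((|Tf g ((1 + η) * x)| + |Tf g x|) / ((1 + η) * x - x) + (Nf r ((1 + η) * x) - Nf r x)) / x := by gcongr
    _ = _ := by
      have : (1 + η) * x - x = η * x := by ring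
      rw [this]
      field_simp
      try ring

end Sys

section ideals
variable {K}
set_option linter.unusedSectionVars false

lemma prime_isPrime {p : Ideal (𝓞 K)} (hp : Prime p) : p.IsPrime := Ideal.isPrime_of_prime hp

lemma prime_of_isPrime {p : Ideal (𝓞 K)} (hp : p.IsPrime) (h0 : p ≠ ⊥) : Prime p :=
  Ideal.prime_of_isPrime h0 hp

lemma prime_eq_of_dvd {p q : Ideal (𝓞 K)} (hp : Prime p) (hq : Prime q) (h : p ∣ q) : p = q :=
  associated_iff_eq.mp (hp.associated_of_dvd hq h)

lemma absNorm_pos' {a : Ideal (𝓞 K)} (ha : a ≠ ⊥) : 0 < absNorm a :=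
  Nat.pos_of_ne_zero (fun h => ha (Ideal.absNorm_eq_zero_iff.mp h))

lemma prime_norm_ge {p : Ideal (𝓞 K)} (hp : Prime p) : 2 ≤ absNorm p := by
  have h1 := absNorm_pos' (a := p) hp.ne_zero
  have h2 : absNorm p ≠ 1 := fun h => hp.not_isUnit (Ideal.isUnit_iff.mpr (Ideal.absNorm_eq_one_iff.mp h))
  omega

lemma finite_contain {a : Ideal (𝓞 K)} (ha : a ≠ ⊥) : {p : Ideal (𝓞 K) | p.IsPrime ∧ a ≤ p}.Finite := by
  refine (Ideal.finite_setOfPred_absNorm_le (absNorm a)).subset fun p hp => ?_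
  exact Nat.le_of_dvd (absNorm_pos' ha) (Ideal.absNorm_dvd_absNorm_of_le hp.2)

lemma muK_one : muK K (1 : Ideal (𝓞 K)) = 1 := by
  have : IsEmpty {p : Ideal (𝓞 K) // p.IsPrime ∧ (1 : Ideal (𝓞 K)) ≤ p} :=
    ⟨fun ⟨p, h1, h2⟩ => h1.ne_top (top_le_iff.mp (by rwa [Ideal.one_eq_top] at h2))⟩
  rw [muK, if_pos squarefree_one, Nat.card_of_isEmpty, pow_zero]

lemma muK_sq {a p : Ideal (𝓞 K)} (hp : Prime p) (h : p * p ∣ a) : muK K a = 0 := by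
  rw [muK, if_neg]
  intro hs
  exact hp.not_isUnit (hs p h)

lemma muK_mul {a p : Ideal (𝓞 K)} (ha : a ≠ ⊥) (hp : Prime p) (h : ¬ p ∣ a) : muK K (p * a) = - muK K a := by
  classical
  have hcop : IsRelPrime p a := by
    intro d h1 h2
    rcases (hp.irreducible.dvd_iff.mp h1) with h | h
    · exact h
    · exact absurd (h.dvd.trans h2) ‹¬ p ∣ a›
  have hsq : Squarefree (p * a) ↔ Squarefree a := by
    constructor
    · exact fun h => h.of_mul_right
    · intro hs
      exact (squarefree_mul_iff).mpr ⟨hcop, hp.squarefree, hs⟩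
  unfold muK
  by_cases hs : Squarefree a
  · rw [if_pos hs, if_pos (hsq.mpr hs)]
    have e : {q : Ideal (𝓞 K) | q.IsPrime ∧ p * a ≤ q} = insert p {q | q.IsPrime ∧ a ≤ q} := by
      ext q
      simp only [Set.mem_ofPred_eq, Set.mem_insert_iff]
      constructor
      · rintro ⟨h1, h2⟩
        rcases h1.mul_le.mp h2 with h3 | h3
        · left
          have hq0 : q ≠ ⊥ := fun hq => hp.ne_zero (le_bot_iff.mp (hq ▸ h3))
          exact (prime_eq_of_dvd (prime_of_isPrime h1 hq0) hp (Ideal.dvd_iff_le.mpr h3))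
        · right; exact ⟨h1, h3⟩
      · rintro (rfl | ⟨h1, h2⟩)
        · exact ⟨prime_isPrime hp, Ideal.mul_le_left⟩
        · exact ⟨h1, Ideal.mul_le_right.trans h2⟩
    have e2 : Nat.card {q : Ideal (𝓞 K) // q.IsPrime ∧ p * a ≤ q} = Nat.card {q : Ideal (𝓞 K) // q.IsPrime ∧ a ≤ q} + 1 := by
      change Nat.card ({q : Ideal (𝓞 K) | q.IsPrime ∧ p * a ≤ q} : Set _) = Nat.card ({q : Ideal (𝓞 K) | q.IsPrime ∧ a ≤ q} : Set _) + 1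
      rw [e, Nat.card_coe_set_eq, Nat.card_coe_set_eq, Set.ncard_insert_of_notMem _ (finite_contain ha)]
      exact fun hh => h (Ideal.dvd_iff_le.mpr hh.2)
    rw [e2, pow_succ]; ring
  · rw [if_neg hs, if_neg (fun h => hs (hsq.mp h))]; simp

lemma muK_abs (a : Ideal (𝓞 K)) : |(muK K a : ℝ)| ≤ 1 := by
  unfold muK
  split_ifs <;> simp

/-- Ideals of norm exactly `n`. -/
def In (K : Type*) [Field K] [NumberField K] (n : ℕ) : Finset (Ideal (𝓞 K)) :=
  (Ideal.finite_setOfPred_absNorm_eq (S := 𝓞 K) n).toFinset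

lemma mem_In {n : ℕ} {a : Ideal (𝓞 K)} : a ∈ In K n ↔ absNorm a = n := by simp [In]

open Classical in
/-- Divisors of an ideal. -/
def dv (a : Ideal (𝓞 K)) : Finset (Ideal (𝓞 K)) :=
  (Ideal.finite_setOfPred_absNorm_le (S := 𝓞 K) (absNorm a)).toFinset.filter (· ∣ a)

lemma mem_dv {a b : Ideal (𝓞 K)} (ha : a ≠ ⊥) : b ∈ dv a ↔ b ∣ a := by
  simp only [dv, Finset.mem_filter, Set.Finite.mem_toFinset, Set.mem_ofPred_eq, and_iff_right_iff_imp]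
  intro h
  exact Nat.le_of_dvd (absNorm_pos' ha) (map_dvd absNorm h)

lemma sum_mu {a : Ideal (𝓞 K)} (ha : a ≠ ⊥) (h1 : a ≠ 1) : ∑ b ∈ dv a, muK K b = 0 := by
  classical
  obtain ⟨p, hp, hpa⟩ : ∃ p, Prime p ∧ p ∣ a :=
    WfDvdMonoid.exists_irreducible_factor (fun h => h1 (by rwa [Ideal.isUnit_iff, ← Ideal.one_eq_top] at h)) ha
      |>.imp fun p h => ⟨h.1.prime, h.2⟩
  rw [← Finset.sum_filter_add_sum_filter_not (dv a) (fun b => p ∣ b)]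
  have hne : ∀ {b}, b ∣ a → b ≠ ⊥ := fun {b} h hb => ha (by
    have := h; rw [hb] at this; exact zero_dvd_iff.mp this)
  have : ∑ b ∈ (dv a).filter (fun b => p ∣ b), muK K b
      = ∑ b ∈ ((dv a).filter (fun b => ¬ p ∣ b)).image (p * ·), muK K b := by
    symm
    apply Finset.sum_subset
    · intro b hb
      simp only [Finset.mem_image, Finset.mem_filter, mem_dv ha] at hb ⊢
      obtain ⟨c, ⟨h1, h2⟩, rfl⟩ := hb
      refine ⟨?_, dvd_mul_right _ _⟩
      obtain ⟨e, rfl⟩ := h1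
      rcases hp.dvd_or_dvd hpa with h | h
      · exact absurd h h2
      · rw [mul_comm p c]; exact mul_dvd_mul_left _ h
    · intro b hb hb2
      simp only [Finset.mem_image, Finset.mem_filter, mem_dv ha, not_exists, not_and] at hb hb2
      obtain ⟨h1, ⟨c, rfl⟩⟩ := hb
      have : p ∣ c := by
        by_contra hc
        exact hb2 c ⟨(dvd_mul_left _ _).trans h1, hc⟩ rfl
      exact muK_sq hp (mul_dvd_mul_left _ this)
  rw [this, Finset.sum_image (fun x _ y _ hxy => mul_left_cancel₀ hp.ne_zero hxy), ← Finset.sum_add_distrib]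
  refine Finset.sum_eq_zero fun b hb => ?_
  simp only [Finset.mem_filter, mem_dv ha] at hb
  rw [muK_mul (hne hb.1) hp hb.2]; ring

open Classical in
/-- von Mangoldt function for ideals -/
def LamK (b : Ideal (𝓞 K)) : ℝ :=
  if h : ∃ p : Ideal (𝓞 K), Prime p ∧ ∃ k : ℕ, b = p ^ (k + 1) then Real.log (absNorm h.choose) else 0

lemma LamK_pow {p : Ideal (𝓞 K)} (hp : Prime p) (k : ℕ) : LamK (p ^ (k + 1)) = Real.log (absNorm p) := by
  have h : ∃ q : Ideal (𝓞 K), Prime q ∧ ∃ j : ℕ, p ^ (k + 1) = q ^ (j + 1) := ⟨p, hp, k, rfl⟩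
  rw [LamK, dif_pos h]
  obtain ⟨h1, j, h2⟩ := h.choose_spec
  have : p ∣ h.choose := hp.dvd_of_dvd_pow (h2 ▸ dvd_pow_self p (by omega))
  rw [← prime_eq_of_dvd hp h1 this]

lemma LamK_zero {b : Ideal (𝓞 K)} (h : ¬ ∃ p : Ideal (𝓞 K), Prime p ∧ ∃ k : ℕ, b = p ^ (k + 1)) : LamK b = 0 := by
  rw [LamK, dif_neg h]

lemma LamK_nonneg (b : Ideal (𝓞 K)) : 0 ≤ LamK b := by
  by_cases h : ∃ p : Ideal (𝓞 K), Prime p ∧ ∃ k : ℕ, b = p ^ (k + 1)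
  · obtain ⟨p, hp, k, rfl⟩ := h
    rw [LamK_pow hp]; exact Real.log_natCast_nonneg _
  · rw [LamK_zero h]

lemma LamK_one : LamK (1 : Ideal (𝓞 K)) = 0 := by
  apply LamK_zero
  rintro ⟨p, hp, k, h⟩
  exact hp.not_isUnit (isUnit_of_dvd_one (h ▸ dvd_pow_self p (by omega)))

lemma sum_Lam (a : Ideal (𝓞 K)) : a ≠ ⊥ → ∑ b ∈ dv a, LamK b = Real.log (absNorm a) := by
  classical
  induction a using UniqueFactorizationMonoid.induction_on_prime with
  | h₁ => intro h; exact absurd rfl h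
  | h₂ x hx =>
    intro h
    have : x = 1 := by rwa [Ideal.isUnit_iff, ← Ideal.one_eq_top] at hx
    subst this
    rw [map_one, Nat.cast_one, Real.log_one]
    refine Finset.sum_eq_zero fun b hb => ?_
    rw [mem_dv h] at hb
    have : b = 1 := by
      have := isUnit_of_dvd_one hb
      rwa [Ideal.isUnit_iff, ← Ideal.one_eq_top] at this
    rw [this, LamK_one]
  | h₃ a p ha0 hp ih =>
    intro hpa
    have ha : a ≠ ⊥ := ha0
    have hN : (absNorm a : ℝ) ≠ 0 := by exact_mod_cast (absNorm_pos' ha).ne'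
    have hNp : (absNorm p : ℝ) ≠ 0 := by exact_mod_cast (absNorm_pos' hp.ne_zero).ne'
    rw [map_mul, Nat.cast_mul, Real.log_mul hNp hN, ← ih ha]
    obtain ⟨v, hv1, hv2⟩ : ∃ v, p ^ v ∣ a ∧ ¬ p ^ (v + 1) ∣ a := by
      have hf := FiniteMultiplicity.of_not_isUnit hp.not_isUnit ha0
      exact ⟨multiplicity p a, pow_multiplicity_dvd p a, hf.not_pow_dvd_of_multiplicity_lt (Nat.lt_succ_self _)⟩
    have hnm : p ^ (v + 1) ∉ dv a := by rw [mem_dv ha]; exact hv2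
    rw [← LamK_pow hp v, ← Finset.sum_insert hnm]
    symm
    apply Finset.sum_subset
    · intro b hb
      rw [Finset.mem_insert, mem_dv ha] at hb
      rw [mem_dv hpa]
      rcases hb with rfl | hb
      · rw [pow_succ']; exact mul_dvd_mul_left _ hv1
      · exact hb.trans (dvd_mul_left _ _)
    · intro b hb hb2
      rw [Finset.mem_insert, mem_dv ha, not_or] at hb2
      rw [mem_dv hpa] at hb
      apply LamK_zero
      rintro ⟨q, hq, k, rfl⟩
      by_cases hqp : q = p
      · subst hqp
        have h1 : q ^ k ∣ a := by
          rw [pow_succ'] at hb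
          exact (mul_dvd_mul_iff_left hq.ne_zero).mp hb
        have h2 : k ≤ v := by
          by_contra hc
          exact hv2 ((pow_dvd_pow q (by omega)).trans h1)
        rcases h2.lt_or_eq with h3 | h3
        · exact hb2.2 ((pow_dvd_pow q (by omega)).trans hv1)
        · exact hb2.1 (by rw [h3])
      · apply hb2.2
        refine hq.pow_dvd_of_dvd_mul_left _ ?_ hb
        exact fun h => hqp (prime_eq_of_dvd hq hp h)

/-- Arithmetic function attached to a function on ideals. -/
def AF (f : Ideal (𝓞 K) → ℝ) : ArithmeticFunction ℝ :=
  ⟨fun n => if n = 0 then 0 else ∑ a ∈ In K n, f a, by simp⟩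

lemma AF_apply (f : Ideal (𝓞 K) → ℝ) {n : ℕ} (hn : n ≠ 0) : AF f n = ∑ a ∈ In K n, f a := by
  simp [AF, hn]

lemma ne_bot_of_In {n : ℕ} (hn : n ≠ 0) {a : Ideal (𝓞 K)} (ha : a ∈ In K n) : a ≠ ⊥ := by
  rw [mem_In] at ha
  rintro rfl
  rw [Ideal.absNorm_bot] at ha
  exact hn ha.symm

lemma AF_mul_one (f : Ideal (𝓞 K) → ℝ) {n : ℕ} (hn : n ≠ 0) :
    (AF f * AF (fun _ : Ideal (𝓞 K) => (1:ℝ))) n = ∑ a ∈ In K n, ∑ b ∈ dv a, f b := by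
  classical
  rw [ArithmeticFunction.mul_apply]
  have e : ∀ x ∈ n.divisorsAntidiagonal, AF f x.1 * AF (fun _ : Ideal (𝓞 K) => (1:ℝ)) x.2
      = ∑ y ∈ In K x.1 ×ˢ In K x.2, f y.1 := by
    intro x hx
    rw [Nat.mem_divisorsAntidiagonal] at hx
    have h1 : x.1 ≠ 0 := fun h => hx.2 (by rw [← hx.1, h, zero_mul])
    have h2 : x.2 ≠ 0 := fun h => hx.2 (by rw [← hx.1, h, mul_zero])
    rw [AF_apply _ h1, AF_apply _ h2, Finset.sum_mul_sum, Finset.sum_product]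
    simp
  rw [Finset.sum_congr rfl e, Finset.sum_sigma', Finset.sum_sigma']
  refine Finset.sum_bij (fun z _ => ⟨z.2.1 * z.2.2, z.2.1⟩) ?_ ?_ ?_ ?_
  · rintro ⟨x, y⟩ hz
    simp only [Finset.mem_sigma, Nat.mem_divisorsAntidiagonal, Finset.mem_product, mem_In] at hz ⊢
    have : absNorm (y.1 * y.2) = n := by rw [map_mul, hz.2.1, hz.2.2, hz.1.1]
    refine ⟨this, ?_⟩
    rw [mem_dv (ne_bot_of_In hn (mem_In.mpr this))]
    exact dvd_mul_right _ _
  · rintro ⟨⟨x1, x2⟩, ⟨y1, y2⟩⟩ hz ⟨⟨u1, u2⟩, ⟨v1, v2⟩⟩ hw h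
    simp only [Finset.mem_sigma, Nat.mem_divisorsAntidiagonal, Finset.mem_product, mem_In] at hz hw
    simp only [Sigma.mk.injEq, heq_eq_eq] at h
    obtain ⟨h1, rfl⟩ := h
    have hy0 : y1 ≠ 0 := by
      rintro rfl
      apply hz.1.2
      rw [← hz.1.1, ← hz.2.1]
      simp
    have := mul_left_cancel₀ hy0 h1
    subst this
    obtain ⟨_, rfl, rfl⟩ := hz
    obtain ⟨_, rfl, rfl⟩ := hw
    rfl
  · rintro ⟨a, b⟩ hz
    simp only [Finset.mem_sigma] at hz
    have ha := ne_bot_of_In hn hz.1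
    rw [mem_dv ha, mem_In] at hz
    obtain ⟨h1, c, rfl⟩ := hz
    refine ⟨⟨(absNorm b, absNorm c), (b, c)⟩, ?_, rfl⟩
    simp only [Finset.mem_sigma, Nat.mem_divisorsAntidiagonal, Finset.mem_product, mem_In]
    exact ⟨⟨by rw [← h1, map_mul], hn⟩, by simp⟩
  · rintro ⟨x, y⟩ hz
    rfl

lemma In_one : In K 1 = {1} := by
  ext a
  simp [mem_In, Ideal.absNorm_eq_one_iff]

lemma norm_LamK {p : Ideal (𝓞 K)} (hp : Prime p) {q k m : ℕ} (h : absNorm (p ^ (k+1)) = q ^ m) :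
    p ∣ span {(q : 𝓞 K)} := by
  rw [Ideal.dvd_span_singleton]
  have h1 : (absNorm (p ^ (k+1)) : 𝓞 K) ∈ p ^ (k+1) := Ideal.absNorm_mem _
  rw [h] at h1
  have h2 := Ideal.pow_le_self (I := p) (n := k+1) (by omega) h1
  push_cast at h2
  exact (prime_isPrime hp).mem_of_pow_mem _ h2

lemma Lm_bound {m : ℕ} (hm : m ≠ 0) :
    AF (LamK (K := K)) m ≤ (Module.finrank ℚ K) * ArithmeticFunction.vonMangoldt m := by
  classical
  rw [AF_apply _ hm]
  by_cases hpp : IsPrimePow m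
  swap
  · have : ∑ a ∈ In K m, LamK a = 0 := by
      refine Finset.sum_eq_zero fun b hb => LamK_zero ?_
      rintro ⟨p, hp, k, rfl⟩
      rw [mem_In] at hb
      apply hpp
      rw [← hb, map_pow]
      have := prime_isPrime hp
      have hpm : p.IsMaximal := this.isMaximal hp.ne_zero
      have : IsPrimePow (absNorm p) := by
        let _ := Ideal.Quotient.field p
        have : Finite (𝓞 K ⧸ p) := Ideal.finiteQuotientOfFreeOfNeBot p hp.ne_zero
        let _ := Fintype.ofFinite (𝓞 K ⧸ p)
        have h3 := Fintype.isPrimePow_card_of_field (α := 𝓞 K ⧸ p)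
        rwa [Ideal.absNorm_apply, Submodule.cardQuot_apply, Nat.card_eq_fintype_card]
      exact this.pow (by omega)
    rw [this]
    exact mul_nonneg (by positivity) ArithmeticFunction.vonMangoldt_nonneg
  obtain ⟨q, j, hq, hj, rfl⟩ := hpp
  have hq := hq.nat_prime
  rw [ArithmeticFunction.vonMangoldt_apply_pow hj.ne', ArithmeticFunction.vonMangoldt_apply_prime hq]
  set T := (In K (q ^ j)).filter (fun b => ∃ p : Ideal (𝓞 K), Prime p ∧ ∃ k : ℕ, b = p ^ (k + 1)) with hT
  have h1 : ∑ a ∈ In K (q^j), LamK a = ∑ a ∈ T, LamK a := by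
    symm
    apply Finset.sum_subset (Finset.filter_subset _ _)
    intro b hb hb2
    apply LamK_zero
    intro h
    exact hb2 (Finset.mem_filter.mpr ⟨hb, h⟩)
  have hTm : ∀ b ∈ T, ∃ p : Ideal (𝓞 K), ∃ k : ℕ, Prime p ∧ b = p ^ (k+1) ∧ absNorm b = q ^ j := by
    intro b hb
    rw [hT, Finset.mem_filter, mem_In] at hb
    obtain ⟨p, hp, k, h⟩ := hb.2
    exact ⟨p, k, hp, h, hb.1⟩
  choose! F G hF1 hF2 hF3 using hTm
  have hinj : Set.InjOn F T := by
    intro b hb c hc hbc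
    have e1 := hF3 b hb
    have e2 := hF3 c hc
    rw [hF2 b hb, map_pow] at e1
    rw [hF2 c hc, map_pow, ← hbc, ← e1] at e2
    have := Nat.pow_right_injective (prime_norm_ge (hF1 b hb)) e2
    rw [hF2 b hb, hF2 c hc, ← hbc, this]
  have h2 : ∑ a ∈ T, LamK a = ∑ p ∈ T.image F, Real.log (absNorm p) := by
    rw [Finset.sum_image hinj]
    refine Finset.sum_congr rfl fun b hb => ?_
    conv_lhs => rw [hF2 b hb]
    rw [LamK_pow (hF1 b hb)]
  have hpr : ∀ p ∈ T.image F, Prime p ∧ p ∣ span {(q : 𝓞 K)} := by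
    intro p hp
    rw [Finset.mem_image] at hp
    obtain ⟨b, hb, rfl⟩ := hp
    refine ⟨hF1 b hb, norm_LamK (hF1 b hb) (k := G b) (m := j) ?_⟩
    rw [← hF2 b hb, hF3 b hb]
  have h3 : ∏ p ∈ T.image F, p ∣ span {(q : 𝓞 K)} :=
    Finset.prod_primes_dvd _ (fun p hp => (hpr p hp).1) (fun p hp => (hpr p hp).2)
  have h4 : absNorm (span {(q : 𝓞 K)}) = q ^ Module.finrank ℚ K := by
    rw [Ideal.absNorm_span_natCast, RingOfIntegers.rank]
  have h5 : ∏ p ∈ T.image F, absNorm p ≤ q ^ Module.finrank ℚ K := by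
    have := map_dvd absNorm h3
    rw [h4, map_prod] at this
    exact Nat.le_of_dvd (pow_pos hq.pos _) this
  have h0 : ∀ p ∈ T.image F, (absNorm p : ℝ) ≠ 0 := fun p hp => by
    exact_mod_cast (absNorm_pos' (hpr p hp).1.ne_zero).ne'
  rw [h1, h2, ← Real.log_prod h0, ← Real.log_pow]
  apply Real.log_le_log
  · apply Finset.prod_pos
    intro p hp
    exact_mod_cast absNorm_pos' (hpr p hp).1.ne_zero
  · exact_mod_cast h5

/-- Nonzero ideals of norm at most `x`. -/
def Id (K : Type*) [Field K] [NumberField K] (x : ℝ) : Finset (Ideal (𝓞 K)) :=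
  ((Ideal.finite_setOfPred_absNorm_le (S := 𝓞 K) ⌊x⌋₊).subset
    (t := {a : Ideal (𝓞 K) | a ≠ ⊥ ∧ absNorm a ≤ ⌊x⌋₊}) (fun _ h => h.2)).toFinset

lemma mem_Id {x : ℝ} {a : Ideal (𝓞 K)} : a ∈ Id K x ↔ a ≠ ⊥ ∧ (absNorm a : ℝ) ≤ x := by
  simp only [Id, Set.Finite.mem_toFinset, Set.mem_ofPred_eq]
  refine and_congr_right fun h => ?_
  rw [Nat.le_floor_iff' (absNorm_pos' h).ne']

lemma sum_AF (f : Ideal (𝓞 K) → ℝ) (x : ℝ) : ∑ n ∈ Finset.Ioc 0 ⌊x⌋₊, AF f n = ∑ a ∈ Id K x, f a := by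
  classical
  have hm : ∀ a ∈ Id K x, absNorm a ∈ Finset.Ioc 0 ⌊x⌋₊ := by
    intro a ha
    rw [mem_Id] at ha
    exact Finset.mem_Ioc.mpr ⟨absNorm_pos' ha.1, Nat.le_floor ha.2⟩
  rw [← Finset.sum_fiberwise_of_maps_to hm]
  refine Finset.sum_congr rfl fun n hn => ?_
  rw [Finset.mem_Ioc] at hn
  rw [AF_apply _ hn.1.ne']
  refine Finset.sum_congr ?_ fun _ _ => rfl
  ext a
  rw [mem_In, Finset.mem_filter, mem_Id]
  constructor
  · intro h
    refine ⟨⟨ne_bot_of_In hn.1.ne' (mem_In.mpr h), ?_⟩, h⟩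
    rw [h]
    exact (Nat.le_floor_iff' hn.1.ne').mp hn.2
  · exact fun h => h.2

/-- the ideal counting function -/
def rK (K : Type*) [Field K] [NumberField K] : ArithmeticFunction ℝ := AF (fun _ : Ideal (𝓞 K) => (1:ℝ))

lemma rK_sum (x : ℝ) : ∑ n ∈ Finset.Ioc 0 ⌊x⌋₊, rK K n = (Nat.card {I : nonZeroDivisors (Ideal (𝓞 K)) // absNorm (I : Ideal (𝓞 K)) ≤ x} : ℝ) := by
  rw [rK, sum_AF, Finset.sum_const, nsmul_eq_mul, mul_one, ← Nat.card_eq_finsetCard]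
  congr 1
  refine Nat.card_congr ?_
  refine (Equiv.subtypeEquivRight fun a => ?_).trans (Equiv.subtypeSubtypeEquivSubtypeInter (fun I : Ideal (𝓞 K) => I ∈ nonZeroDivisors (Ideal (𝓞 K))) (fun I => (absNorm I : ℝ) ≤ x)).symm
  rw [mem_Id, mem_nonZeroDivisors_iff_ne_zero]
  rfl

lemma exists_sys (K : Type*) [Field K] [NumberField K] : ∃ C, Sys (rK K) (AF (fun a : Ideal (𝓞 K) => (muK K a : ℝ))) (AF (LamK (K := K))) (dedekindZeta_residue K) C
    (Module.finrank ℚ K) := by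
  have hlim : Tendsto (fun x : ℝ => (∑ n ∈ Finset.Ioc 0 ⌊x⌋₊, rK K n) / x) atTop (nhds (dedekindZeta_residue K)) := by
    simp only [rK_sum]
    exact Ideal.tendsto_norm_le_div_atTop₀ K
  have hr0 : ∀ n, 0 ≤ rK K n := fun n => by
    by_cases hn : n = 0
    · simp [hn]
    · rw [rK, AF_apply _ hn]; exact Finset.sum_nonneg fun _ _ => zero_le_one
  obtain ⟨C, hC, hCb⟩ : ∃ C : ℝ, 0 < C ∧ ∀ x : ℝ, 0 ≤ x → ∑ n ∈ Finset.Ioc 0 ⌊x⌋₊, rK K n ≤ C * x := by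
    have h1 := hlim.eventually (gt_mem_nhds (lt_add_one (dedekindZeta_residue K)))
    obtain ⟨A, hA⟩ := (h1.and (eventually_gt_atTop 1)).exists_forall_of_atTop
    have hc := dedekindZeta_residue_pos K
    set B := ∑ n ∈ Finset.Ioc 0 ⌊A⌋₊, rK K n
    have hB : 0 ≤ B := Finset.sum_nonneg fun n _ => hr0 n
    refine ⟨dedekindZeta_residue K + 1 + B, by positivity, fun x hx => ?_⟩
    rcases lt_or_ge x 1 with h | h
    · rw [Nat.floor_eq_zero.mpr h]
      simp only [Finset.Ioc_self, Finset.sum_empty]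
      positivity
    rcases le_total A x with h2 | h2
    · have := (hA x h2).1
      rw [div_lt_iff₀ (by linarith)] at this
      nlinarith
    · have : ∑ n ∈ Finset.Ioc 0 ⌊x⌋₊, rK K n ≤ B :=
        Finset.sum_le_sum_of_subset_of_nonneg (Finset.Ioc_subset_Ioc_right (Nat.floor_le_floor h2)) fun n _ _ => hr0 n
      nlinarith
  refine ⟨C, ?_⟩
  constructor
  · exact hr0
  · rw [rK, AF_apply _ one_ne_zero, In_one]; simp
  · intro n
    by_cases hn : n = 0
    · simp [hn]
    rw [rK, AF_apply _ hn, AF_apply _ hn]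
    exact (Finset.abs_sum_le_sum_abs _ _).trans (Finset.sum_le_sum fun a _ => muK_abs a)
  · intro n
    by_cases hn : n = 0
    · simp [hn]
    · rw [AF_apply _ hn]; exact Finset.sum_nonneg fun _ _ => LamK_nonneg _
  · intro n
    by_cases hn : n = 0
    · simp [hn]
    · exact Lm_bound hn
  · ext n
    by_cases hn : n = 0
    · simp [hn]
    rw [rK, mul_comm, AF_mul_one _ hn, ArithmeticFunction.one_apply]
    split_ifs with h
    · subst h
      rw [In_one, Finset.sum_singleton]
      have : dv (1 : Ideal (𝓞 K)) = {1} := by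
        ext b
        rw [mem_dv (by rw [Ideal.one_eq_top]; exact top_ne_bot), Finset.mem_singleton, ← isUnit_iff_dvd_one, Ideal.isUnit_iff, Ideal.one_eq_top]
      rw [this, Finset.sum_singleton, muK_one]; simp
    · refine Finset.sum_eq_zero fun a ha => ?_
      rw [← Int.cast_sum, sum_mu (ne_bot_of_In hn ha), Int.cast_zero]
      rintro rfl
      rw [mem_In, map_one] at ha
      exact h ha.symm
  · ext n
    by_cases hn : n = 0
    · simp [hn]
    rw [rK, AF_mul_one _ hn, ArithmeticFunction.pmul_apply, AF_apply _ hn, ArithmeticFunction.log_apply, Finset.sum_mul]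
    refine Finset.sum_congr rfl fun a ha => ?_
    rw [sum_Lam a (ne_bot_of_In hn ha), mem_In.mp ha, one_mul]
  · exact dedekindZeta_residue_pos K
  · positivity
  · exact hC
  · exact hlim
  · exact hCb

lemma sieve_bound {F G : ℝ → ℝ} {q C : ℝ} (hq : 2 ≤ q) (hC : 0 ≤ C) (hF : ∀ x, 0 ≤ x → |F x| ≤ C * x)
    (hFG : ∀ x, 0 ≤ x → F x = G x + F (x / q)) (hG : Tendsto (fun x => G x / x) atTop (nhds 0)) :
    Tendsto (fun x => F x / x) atTop (nhds 0) := by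
  rw [Metric.tendsto_atTop] at hG ⊢
  intro ε hε
  obtain ⟨A0, hA0⟩ := hG (ε / 4) (by positivity)
  set A := max A0 1
  have hA1 : 1 ≤ A := le_max_right _ _
  have hGA : ∀ x, A ≤ x → |G x| ≤ ε / 4 * x := by
    intro x hx
    have h1 := hA0 x ((le_max_left _ _).trans hx)
    have hx0 : 0 < x := by linarith
    rw [Real.dist_eq, sub_zero, abs_div, abs_of_pos hx0, div_lt_iff₀ hx0] at h1
    exact h1.le
  have key : ∀ n : ℕ, ∀ x : ℝ, 0 ≤ x → x ≤ A * 2 ^ n → |F x| ≤ ε / 2 * x + C * A := by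
    intro n
    induction n with
    | zero =>
      intro x hx hxA
      rw [pow_zero, mul_one] at hxA
      have h1 := hF x hx
      have h2 : C * x ≤ C * A := by gcongr
      have : 0 ≤ ε / 2 * x := by positivity
      linarith
    | succ n ih =>
      intro x hx hxA
      rcases le_total x A with h | h
      · have h1 := hF x hx
        have h2 : C * x ≤ C * A := by gcongr
        have : 0 ≤ ε / 2 * x := by positivity
        linarith
      · have hq2 : x / q ≤ x / 2 := div_le_div_of_nonneg_left hx (by norm_num) hq
        have h1 := ih (x / q) (by positivity) (by rw [pow_succ] at hxA; linarith)
        have h2 := hGA x h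
        rw [hFG x hx]
        have h3 := abs_add_le (G x) (F (x / q))
        have h4 : ε / 2 * (x / q) ≤ ε / 2 * (x / 2) := by gcongr
        linarith
  refine ⟨max A (4 * C * A / ε), fun x hx => ?_⟩
  have hxA : A ≤ x := (le_max_left _ _).trans hx
  have hx0 : 0 < x := by linarith
  have hx2 : 4 * C * A / ε ≤ x := (le_max_right _ _).trans hx
  rw [div_le_iff₀ hε] at hx2
  obtain ⟨n, hn⟩ := pow_unbounded_of_one_lt x (one_lt_two)
  have := key n x hx0.le (hn.le.trans (by nlinarith [pow_pos (two_pos (α := ℝ)) n]))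
  rw [Real.dist_eq, sub_zero, abs_div, abs_of_pos hx0, div_lt_iff₀ hx0]
  nlinarith

open Classical in
/-- nonzero ideals of norm at most `x` not divisible by any element of `P` -/
def cop (P : Finset (Ideal (𝓞 K))) (x : ℝ) : Finset (Ideal (𝓞 K)) :=
  (Id K x).filter (fun a => ∀ p ∈ P, ¬ p ∣ a)

lemma mem_cop {P : Finset (Ideal (𝓞 K))} {x : ℝ} {a : Ideal (𝓞 K)} :
    a ∈ cop P x ↔ (a ≠ ⊥ ∧ (absNorm a : ℝ) ≤ x) ∧ ∀ p ∈ P, ¬ p ∣ a := by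
  simp [cop, mem_Id]

lemma cop_empty (x : ℝ) : cop (∅ : Finset (Ideal (𝓞 K))) x = Id K x := by
  ext a; simp [mem_cop, mem_Id]

open Classical in
lemma cop_split {P : Finset (Ideal (𝓞 K))} (hP : ∀ q ∈ P, Prime q) {p : Ideal (𝓞 K)} (hp : Prime p) (hpP : p ∉ P)
    (f : Ideal (𝓞 K) → ℝ) (x : ℝ) :
    ∑ a ∈ cop P x, f a = ∑ a ∈ cop (insert p P) x, f a + ∑ c ∈ cop P (x / absNorm p), f (p * c) := by
  have hN : (0:ℝ) < absNorm p := by exact_mod_cast absNorm_pos' hp.ne_zero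
  rw [← Finset.sum_filter_not_add_sum_filter (cop P x) (fun a => p ∣ a)]
  congr 1
  · refine Finset.sum_congr ?_ fun _ _ => rfl
    ext a
    simp only [Finset.mem_filter, mem_cop, Finset.forall_mem_insert]
    tauto
  · rw [← Finset.sum_image (f := f) (g := fun c => p * c) (fun x _ y _ hxy => mul_left_cancel₀ hp.ne_zero hxy)]
    refine Finset.sum_congr ?_ fun _ _ => rfl
    ext a
    simp only [Finset.mem_filter, mem_cop, Finset.mem_image]
    have key : ∀ c : Ideal (𝓞 K), (∀ q ∈ P, ¬ q ∣ p * c) ↔ (∀ q ∈ P, ¬ q ∣ c) := by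
      intro c
      refine forall₂_congr fun q hq => not_congr ⟨fun h => ?_, fun h => h.mul_left _⟩
      rcases (hP q hq).dvd_or_dvd h with h | h
      · exact absurd (prime_eq_of_dvd (hP q hq) hp h ▸ hq) hpP
      · exact h
    constructor
    · rintro ⟨⟨⟨h1, h2⟩, h3⟩, ⟨c, rfl⟩⟩
      refine ⟨c, ⟨⟨?_, ?_⟩, (key c).mp h3⟩, rfl⟩
      · rintro rfl; exact h1 (mul_zero _)
      · rw [le_div_iff₀ hN]
        rw [map_mul] at h2; push_cast at h2; linarith
    · rintro ⟨c, ⟨⟨h1, h2⟩, h3⟩, rfl⟩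
      refine ⟨⟨⟨mul_ne_zero hp.ne_zero h1, ?_⟩, (key c).mpr h3⟩, dvd_mul_right _ _⟩
      rw [le_div_iff₀ hN] at h2
      rw [map_mul]; push_cast; linarith

lemma cop_mu_split {P : Finset (Ideal (𝓞 K))} (hP : ∀ q ∈ P, Prime q) {p : Ideal (𝓞 K)} (hp : Prime p) (hpP : p ∉ P)
    (x : ℝ) [DecidableEq (Ideal (𝓞 K))] :
    ∑ a ∈ cop P x, (muK K a : ℝ) = ∑ a ∈ cop (insert p P) x, (muK K a : ℝ) - ∑ c ∈ cop (insert p P) (x / absNorm p), (muK K c : ℝ) := by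
  have h1 := cop_split hP hp hpP (fun a => (muK K a : ℝ)) x
  have h2 : ∑ c ∈ cop P (x / absNorm p), (muK K (p * c) : ℝ) = - ∑ c ∈ cop (insert p P) (x / absNorm p), (muK K c : ℝ) := by
    rw [← Finset.sum_neg_distrib]
    symm
    have hsub : cop (insert p P) (x / absNorm p) ⊆ cop P (x / absNorm p) := by
      intro a ha
      rw [mem_cop, Finset.forall_mem_insert] at ha
      exact mem_cop.mpr ⟨ha.1, ha.2.2⟩
    rw [← Finset.sum_subset hsub]
    · refine Finset.sum_congr rfl fun a ha => ?_
      rw [mem_cop, Finset.forall_mem_insert] at ha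
      rw [muK_mul ha.1.1 hp ha.2.1]; simp
    · intro a ha ha2
      rw [mem_cop] at ha
      rw [mem_cop, Finset.forall_mem_insert] at ha2
      have : p ∣ a := by
        by_contra hc
        exact ha2 ⟨ha.1, hc, ha.2⟩
      rw [muK_sq hp (mul_dvd_mul_left _ this)]; simp
  rw [h2] at h1
  convert h1 using 1
  rw [sub_eq_add_neg]
  congr!

lemma count_le : ∃ C : ℝ, 0 < C ∧ ∀ x : ℝ, 0 ≤ x → ((Id K x).card : ℝ) ≤ C * x := by
  obtain ⟨C, h⟩ := exists_sys K
  refine ⟨C, h.C_pos, fun x hx => ?_⟩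
  have := h.bd x hx
  rw [rK, sum_AF] at this
  simpa using this

lemma count_lim : Tendsto (fun x : ℝ => ((Id K x).card : ℝ) / x) atTop (nhds (dedekindZeta_residue K)) := by
  obtain ⟨C, h⟩ := exists_sys K
  have := h.lim
  simp only [rK, sum_AF] at this
  simpa using this

lemma cop_sub (P : Finset (Ideal (𝓞 K))) (x : ℝ) : cop P x ⊆ Id K x := by
  classical
  exact Finset.filter_subset _ _

lemma cop_mu (P : Finset (Ideal (𝓞 K))) (hP : ∀ q ∈ P, Prime q) :
    Tendsto (fun x : ℝ => (∑ a ∈ cop P x, (muK K a : ℝ)) / x) atTop (nhds 0) := by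
  classical
  induction P using Finset.induction_on with
  | empty =>
    obtain ⟨C, h⟩ := exists_sys K
    have := h.main
    simp only [sum_AF] at this
    simpa only [cop_empty] using this
  | insert p P hpP ih =>
    rw [Finset.forall_mem_insert] at hP
    obtain ⟨C, hC, hCb⟩ := count_le (K := K)
    refine sieve_bound (q := absNorm p) (C := C) (G := fun x => ∑ a ∈ cop P x, (muK K a : ℝ))
      (by exact_mod_cast prime_norm_ge hP.1) hC.le ?_ ?_ (ih hP.2)
    · intro x hx
      refine le_trans ?_ (hCb x hx)
      calc |∑ a ∈ cop (insert p P) x, (muK K a : ℝ)| ≤ ∑ a ∈ cop (insert p P) x, |(muK K a : ℝ)| := Finset.abs_sum_le_sum_abs _ _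
        _ ≤ ∑ a ∈ cop (insert p P) x, 1 := Finset.sum_le_sum fun a _ => muK_abs a
        _ ≤ _ := by
          rw [Finset.sum_const, nsmul_eq_mul, mul_one]
          exact_mod_cast Finset.card_le_card (cop_sub _ _)
    · intro x _
      have := cop_mu_split hP.2 hP.1 hpP x
      linarith

lemma cop_count (P : Finset (Ideal (𝓞 K))) (hP : ∀ q ∈ P, Prime q) :
    Tendsto (fun x : ℝ => ((cop P x).card : ℝ) / x) atTop
      (nhds (dedekindZeta_residue K * ∏ p ∈ P, (1 - 1 / (absNorm p : ℝ)))) := by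
  classical
  induction P using Finset.induction_on with
  | empty => simpa [cop_empty] using count_lim (K := K)
  | insert p P hpP ih =>
    rw [Finset.forall_mem_insert] at hP
    have hN : (0:ℝ) < absNorm p := by exact_mod_cast absNorm_pos' hP.1.ne_zero
    have h1 := ih hP.2
    have h2 := (h1.comp (tendsto_id.atTop_div_const hN)).div_const (absNorm p : ℝ)
    have h3 := h1.sub h2
    rw [Finset.prod_insert hpP]
    convert h3 using 1
    · ext x
      have := cop_split hP.2 hP.1 hpP (fun _ => 1) x
      simp only [Finset.sum_const, nsmul_eq_mul, mul_one] at this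
      have e : ((cop (insert p P) x).card : ℝ) = (cop P x).card - (cop P (x / absNorm p)).card := by
        rw [this]
        have : cop (insert p P) x = @cop K _ _ (@insert _ _ (@Finset.instInsert _ (Classical.decEq _)) p P) x := by congr!
        rw [this]; ring
      rw [e, sub_div]
      simp only [Function.comp, id]
      rw [div_div, div_mul_cancel₀ _ hN.ne']
    · congr 1; ring

lemma Id_mono {x y : ℝ} (h : x ≤ y) : Id K x ⊆ Id K y := by
  intro a ha
  rw [mem_Id] at ha ⊢
  exact ⟨ha.1, ha.2.trans h⟩

lemma cop_recip_split (P : Finset (Ideal (𝓞 K))) (hP : ∀ q ∈ P, Prime q) (x : ℝ) (hx : 0 ≤ x) :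
    (∑ a ∈ Id K x, 1 / (absNorm a : ℝ)) * ∏ p ∈ P, (1 - 1 / (absNorm p : ℝ)) ≤ ∑ a ∈ cop P x, 1 / (absNorm a : ℝ) := by
  classical
  induction P using Finset.induction_on with
  | empty => simp [cop_empty]
  | insert p P hpP ih =>
    rw [Finset.forall_mem_insert] at hP
    have hN : (2:ℝ) ≤ absNorm p := by exact_mod_cast prime_norm_ge hP.1
    have h1 := ih hP.2
    have h2 := cop_split hP.2 hP.1 hpP (fun a => 1 / (absNorm a : ℝ)) x
    have h3 : ∑ c ∈ cop P (x / absNorm p), 1 / (absNorm (p * c) : ℝ) ≤ 1 / absNorm p * ∑ c ∈ cop P x, 1 / (absNorm c : ℝ) := by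
      rw [Finset.mul_sum]
      refine (Finset.sum_le_sum_of_subset_of_nonneg (t := cop P x) ?_ fun _ _ _ => by positivity).trans (le_of_eq ?_)
      · intro a ha
        rw [mem_cop] at ha ⊢
        exact ⟨⟨ha.1.1, ha.1.2.trans (div_le_self hx (by linarith))⟩, ha.2⟩
      · refine Finset.sum_congr rfl fun a _ => ?_
        rw [map_mul]; push_cast
        rw [one_div_mul_one_div]
    rw [Finset.prod_insert hpP]
    have h4 : 0 ≤ 1 - 1 / (absNorm p : ℝ) := by
      rw [sub_nonneg, div_le_one (by linarith)]; linarith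
    have h5 := mul_le_mul_of_nonneg_left h1 h4
    rw [mul_left_comm]
    refine h5.trans ?_
    rw [sub_mul, one_mul]
    linarith

open Classical in
/-- nonzero primes of norm at most `y` -/
def PL (K : Type*) [Field K] [NumberField K] (y : ℝ) : Finset (Ideal (𝓞 K)) := (Id K y).filter Prime

lemma mem_PL {y : ℝ} {p : Ideal (𝓞 K)} : p ∈ PL K y ↔ Prime p ∧ (absNorm p : ℝ) ≤ y := by
  simp only [PL, Finset.mem_filter, mem_Id]
  exact ⟨fun h => ⟨h.2, h.1.2⟩, fun h => ⟨⟨h.1.ne_zero, h.2⟩, h.1⟩⟩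

lemma cop_PL (y : ℝ) : cop (PL K y) y ⊆ {1} := by
  intro a ha
  rw [mem_cop] at ha
  rw [Finset.mem_singleton]
  by_contra h1
  obtain ⟨p, hp, hpa⟩ : ∃ p, Prime p ∧ p ∣ a :=
    WfDvdMonoid.exists_irreducible_factor (fun h => h1 (by rwa [Ideal.isUnit_iff, ← Ideal.one_eq_top] at h)) ha.1.1
      |>.imp fun p h => ⟨h.1.prime, h.2⟩
  refine ha.2 p (mem_PL.mpr ⟨hp, le_trans ?_ ha.1.2⟩) hpa
  exact_mod_cast Nat.le_of_dvd (absNorm_pos' ha.1.1) (map_dvd absNorm hpa)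

lemma recip_div (B : ℝ) : ∃ y : ℝ, 0 ≤ y ∧ B ≤ ∑ a ∈ Id K y, 1 / (absNorm a : ℝ) := by
  classical
  have hc := dedekindZeta_residue_pos K
  set c := dedekindZeta_residue K
  have hl := count_lim (K := K)
  have hl2 := (hl.comp (tendsto_id.const_mul_atTop (two_pos (α := ℝ)))).sub (hl.div_const 2)
  have hev := hl2.eventually (lt_mem_nhds (show c / 4 < c - c / 2 by linarith))
  obtain ⟨A, hA⟩ := (hev.and (eventually_gt_atTop 0)).exists_forall_of_atTop
  have hA0 : 0 < A := (hA A le_rfl).2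
  have step : ∀ x, A ≤ x → (∑ a ∈ Id K x, 1 / (absNorm a : ℝ)) + c / 4 ≤ ∑ a ∈ Id K (2 * x), 1 / (absNorm a : ℝ) := by
    intro x hx
    have hx0 : 0 < x := by linarith
    have h1 := (hA x hx).1
    simp only [Function.comp, id] at h1
    have hsub : Id K x ⊆ Id K (2 * x) := Id_mono (by linarith)
    rw [← Finset.sum_sdiff hsub, add_comm]
    gcongr
    have h2 : ∑ a ∈ Id K (2 * x) \ Id K x, 1 / (2 * x) ≤ ∑ a ∈ Id K (2 * x) \ Id K x, 1 / (absNorm a : ℝ) := by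
      refine Finset.sum_le_sum fun a ha => ?_
      rw [Finset.mem_sdiff, mem_Id] at ha
      have : (0:ℝ) < absNorm a := by exact_mod_cast absNorm_pos' ha.1.1
      exact one_div_le_one_div_of_le this ha.1.2
    refine le_trans ?_ h2
    rw [Finset.sum_const, nsmul_eq_mul, Finset.cast_card_sdiff hsub]
    refine h1.le.trans (le_of_eq ?_)
    field_simp
  have it : ∀ k : ℕ, (k : ℝ) * (c / 4) ≤ ∑ a ∈ Id K (2 ^ k * A), 1 / (absNorm a : ℝ) := by
    intro k
    induction k with
    | zero => simp only [Nat.cast_zero, zero_mul]; positivity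
    | succ k ih =>
      have h1 : (1:ℝ) ≤ 2 ^ k := one_le_pow₀ (by norm_num)
      have := step (2 ^ k * A) (by nlinarith)
      rw [← mul_assoc, ← pow_succ'] at this
      push_cast; linarith
  obtain ⟨k, hk⟩ := exists_nat_ge (B / (c / 4))
  refine ⟨2 ^ k * A, by positivity, le_trans ?_ (it k)⟩
  rwa [div_le_iff₀ (by positivity)] at hk

lemma prod_small {ε : ℝ} (hε : 0 < ε) : ∃ y : ℝ, ∏ p ∈ PL K y, (1 - 1 / (absNorm p : ℝ)) < ε := by
  obtain ⟨y, hy, hB⟩ := recip_div (K := K) (2 / ε)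
  refine ⟨y, ?_⟩
  have h1 := cop_recip_split (PL K y) (fun q hq => (mem_PL.mp hq).1) y hy
  have h2 : ∑ a ∈ cop (PL K y) y, 1 / (absNorm a : ℝ) ≤ 1 := by
    refine (Finset.sum_le_sum_of_subset_of_nonneg (cop_PL y) fun _ _ _ => by positivity).trans ?_
    simp
  have h3 : 0 ≤ ∏ p ∈ PL K y, (1 - 1 / (absNorm p : ℝ)) := by
    refine Finset.prod_nonneg fun p hp => ?_
    have : (2:ℝ) ≤ absNorm p := by exact_mod_cast prime_norm_ge (mem_PL.mp hp).1
    rw [sub_nonneg, div_le_one (by linarith)]; linarith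
  have h4 := (mul_le_mul_of_nonneg_right hB h3).trans (h1.trans h2)
  rw [div_mul_eq_mul_div, div_le_one hε] at h4
  linarith

lemma prime_of_contain {a q : Ideal (𝓞 K)} (ha : a ≠ ⊥) (hq : q.IsPrime) (h : a ≤ q) : Prime q :=
  prime_of_isPrime hq (fun h0 => ha (le_bot_iff.mp (h0 ▸ h)))

/-- sieving condition for unique minimal prime -/
def Dp (p a : Ideal (𝓞 K)) : Prop := p ∣ a ∧ ∀ q : Ideal (𝓞 K), Prime q → absNorm q ≤ absNorm p → q ∣ a → q = p

lemma Dp_iff {p a : Ideal (𝓞 K)} (ha : a ≠ ⊥) (hp : Prime p) :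
    Dp p a ↔ MinimalPrime K a p ∧ ∀ q : Ideal (𝓞 K), MinimalPrime K a q → q = p := by
  constructor
  · rintro ⟨h1, h2⟩
    have hm : MinimalPrime K a p := by
      refine ⟨prime_isPrime hp, Ideal.dvd_iff_le.mp h1, fun q hq hqa => ?_⟩
      by_contra hc
      push Not at hc
      have := h2 q (prime_of_contain ha hq hqa) hc.le (Ideal.dvd_iff_le.mpr hqa)
      rw [this] at hc
      exact lt_irrefl _ hc
    refine ⟨hm, fun q hq => ?_⟩
    exact h2 q (prime_of_contain ha hq.1 hq.2.1) (hq.2.2 p hm.1 hm.2.1) (Ideal.dvd_iff_le.mpr hq.2.1)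
  · rintro ⟨h1, h2⟩
    refine ⟨Ideal.dvd_iff_le.mpr h1.2.1, fun q hq hqp hqa => h2 q ?_⟩
    exact ⟨prime_isPrime hq, Ideal.dvd_iff_le.mp hqa, fun q' h3 h4 => hqp.trans (h1.2.2 q' h3 h4)⟩

open Classical in
lemma Dp_sum {p : Ideal (𝓞 K)} (hp : Prime p) :
    Tendsto (fun x : ℝ => (∑ a ∈ (Id K x).filter (Dp p), (muK K a : ℝ)) / x) atTop (nhds 0) := by
  have hPp : ∀ q ∈ (PL K (absNorm p)).erase p, Prime q := fun q hq => (mem_PL.mp (Finset.mem_of_mem_erase hq)).1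
  have h1 := cop_mu ((PL K (absNorm p)).erase p) hPp
  have h2 := cop_mu (PL K (absNorm p)) (fun q hq => (mem_PL.mp hq).1)
  have h3 := h1.sub h2
  rw [sub_zero] at h3
  refine h3.congr fun x => ?_
  rw [← sub_div]
  congr 1
  rw [sub_eq_iff_eq_add, ← Finset.sum_union]
  · refine Finset.sum_congr ?_ fun _ _ => rfl
    ext a
    simp only [Finset.mem_union, Finset.mem_filter, mem_cop, mem_Id, Finset.mem_erase, mem_PL, Dp, Nat.cast_le]
    constructor
    · rintro ⟨h1, h2⟩
      by_cases hpa : p ∣ a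
      · left
        refine ⟨h1, hpa, fun q hq hqp hqa => ?_⟩
        by_contra hc
        exact h2 q ⟨hc, hq, hqp⟩ hqa
      · right
        refine ⟨h1, fun q hq hqa => ?_⟩
        by_cases hqp : q = p
        · exact hpa (hqp ▸ hqa)
        · exact h2 q ⟨hqp, hq⟩ hqa
    · rintro (⟨h1, h2, h3⟩ | ⟨h1, h2⟩)
      · exact ⟨h1, fun q hq hqa => hq.1 (h3 q hq.2.1 hq.2.2 hqa)⟩
      · exact ⟨h1, fun q hq => h2 q hq.2⟩
  · rw [Finset.disjoint_left]
    intro a ha ha2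
    rw [mem_cop] at ha2
    exact ha2.2 p (mem_PL.mpr ⟨hp, le_rfl⟩) (Finset.mem_filter.mp ha).2.1

open Classical in
lemma pointwise (S : Set (Ideal (𝓞 K))) {y : ℝ} {a : Ideal (𝓞 K)} (ha : a ≠ ⊥) (h : ∃ p ∈ PL K y, p ∣ a) :
    (if InD K S a then (1:ℝ) else 0) = ∑ p ∈ (PL K y).filter (· ∈ S), if Dp p a then (1:ℝ) else 0 := by
  split_ifs with hD
  · obtain ⟨p, h1, h2, h3⟩ := hD
    have hp := prime_of_contain ha h1.1 h1.2.1
    have hpm : p ∈ (PL K y).filter (· ∈ S) := by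
      obtain ⟨q, hq, hqa⟩ := h
      rw [mem_PL] at hq
      refine Finset.mem_filter.mpr ⟨mem_PL.mpr ⟨hp, le_trans ?_ hq.2⟩, h2⟩
      exact_mod_cast h1.2.2 q (prime_isPrime hq.1) (Ideal.dvd_iff_le.mp hqa)
    rw [Finset.sum_eq_single_of_mem p hpm, if_pos ((Dp_iff ha hp).mpr ⟨h1, h3⟩)]
    intro q hq hqp
    rw [Finset.mem_filter, mem_PL] at hq
    rw [if_neg]
    intro hh
    exact hqp (h3 q ((Dp_iff ha hq.1.1).mp hh).1)
  · symm
    refine Finset.sum_eq_zero fun p hp => ?_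
    rw [Finset.mem_filter, mem_PL] at hp
    rw [if_neg]
    intro hh
    have := (Dp_iff ha hp.1.1).mp hh
    exact hD ⟨p, this.1, hp.2, this.2⟩

open Classical in
lemma total_bound (S : Set (Ideal (𝓞 K))) (y x : ℝ) :
    |∑ a ∈ Id K x, (muK K a : ℝ) * (if InD K S a then 1 else 0)| ≤
      |∑ p ∈ (PL K y).filter (· ∈ S), ∑ a ∈ (Id K x).filter (Dp p), (muK K a : ℝ)| + (cop (PL K y) x).card := by
  have e : ∑ p ∈ (PL K y).filter (· ∈ S), ∑ a ∈ (Id K x).filter (Dp p), (muK K a : ℝ)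
      = ∑ a ∈ Id K x, (muK K a : ℝ) * ∑ p ∈ (PL K y).filter (· ∈ S), if Dp p a then (1:ℝ) else 0 := by
    simp only [Finset.sum_filter (p := Dp _), Finset.mul_sum]
    rw [Finset.sum_comm]
    refine Finset.sum_congr rfl fun a _ => Finset.sum_congr rfl fun p _ => ?_
    simp
  rw [e]
  have h2 : |∑ a ∈ Id K x, (muK K a : ℝ) * (if InD K S a then 1 else 0) -
      ∑ a ∈ Id K x, (muK K a : ℝ) * ∑ p ∈ (PL K y).filter (· ∈ S), if Dp p a then (1:ℝ) else 0|
      ≤ (cop (PL K y) x).card := by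
    rw [← Finset.sum_sub_distrib]
    have hsub := cop_sub (PL K y) x
    rw [← Finset.sum_subset hsub]
    · refine (Finset.abs_sum_le_sum_abs _ _).trans ?_
      refine (Finset.sum_le_sum (g := fun _ => (1:ℝ)) fun a ha => ?_).trans (by simp)
      rw [mem_cop] at ha
      have : ∑ p ∈ (PL K y).filter (· ∈ S), (if Dp p a then (1:ℝ) else 0) = 0 := by
        refine Finset.sum_eq_zero fun p hp => ?_
        rw [if_neg]
        exact fun hh => ha.2 p (Finset.mem_filter.mp hp).1 hh.1
      rw [this, mul_zero, sub_zero]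
      split_ifs
      · rw [mul_one]; exact muK_abs a
      · simp
    · intro a ha ha2
      rw [mem_Id] at ha
      rw [pointwise S ha.1 (y := y), sub_self]
      by_contra hc
      push Not at hc
      exact ha2 (mem_cop.mpr ⟨ha, hc⟩)
  have := abs_sub_abs_le_abs_sub (∑ a ∈ Id K x, (muK K a : ℝ) * (if InD K S a then 1 else 0)) 
      (∑ a ∈ Id K x, (muK K a : ℝ) * ∑ p ∈ (PL K y).filter (· ∈ S), if Dp p a then (1:ℝ) else 0)
  linarith

open Classical in
lemma final_aux (S : Set (Ideal (𝓞 K))) :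
    Tendsto (fun x : ℝ => (∑ a ∈ Id K x, (muK K a : ℝ) * (if InD K S a then 1 else 0)) / x) atTop (nhds 0) := by
  rw [Metric.tendsto_nhds]
  intro ε hε
  have hc := dedekindZeta_residue_pos K
  obtain ⟨y, hy⟩ := prod_small (K := K) (ε := ε / 2 / dedekindZeta_residue K) (by positivity)
  rw [lt_div_iff₀ hc, mul_comm] at hy
  have h1 := cop_count (PL K y) (fun q hq => (mem_PL.mp hq).1)
  have h2 : Tendsto (fun x : ℝ => (∑ p ∈ (PL K y).filter (· ∈ S), ∑ a ∈ (Id K x).filter (Dp p), (muK K a : ℝ)) / x) atTop (nhds 0) := by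
    rw [← Finset.sum_const_zero (s := (PL K y).filter (· ∈ S))]
    refine (tendsto_finsetSum _ fun p hp => Dp_sum (p := p) ?_).congr fun x => (Finset.sum_div _ _ _).symm
    exact (mem_PL.mp (Finset.mem_filter.mp hp).1).1
  filter_upwards [h1.eventually (gt_mem_nhds hy), (Metric.tendsto_nhds.mp h2) (ε / 2) (by positivity), eventually_gt_atTop 0] with x a1 a2 hx
  rw [Real.dist_eq, sub_zero, abs_div, abs_of_pos hx] at a2 ⊢
  have := div_le_div_of_nonneg_right (total_bound S y x) hx.le
  rw [add_div] at this
  linarith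

end ideals

open Classical in
/-- `∑_{N(a) ≤ X} μ(a) 𝟙_D(a) = o(X)`. -/
theorem mu_indicator_sum_little_o (S : Set (Ideal (𝓞 K))) (hS : ∀ p ∈ S, p.IsPrime) :
    Tendsto (fun X : ℝ =>
        (∑' a : {a : Ideal (𝓞 K) // a ≠ ⊥ ∧ (absNorm a : ℝ) ≤ X},
          (muK K a.1 : ℝ) * (if InD K S a.1 then 1 else 0)) / X)
      atTop (nhds 0) := by
  refine (final_aux S).congr fun x => ?_
  congr 1
  rw [← Finset.tsum_subtype (Id K x) (fun a => (muK K a : ℝ) * (if InD K S a then 1 else 0))]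
  exact (Equiv.subtypeEquivRight fun a => mem_Id (K := K) (x := x)).tsum_eq
    (fun a : {a : Ideal (𝓞 K) // a ≠ ⊥ ∧ (absNorm a : ℝ) ≤ x} => (muK K a.1 : ℝ) * (if InD K S a.1 then 1 else 0))

end AlladiGen
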